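/- Empty cells: With C₄^{c,1} = {H₂₂₂ > −4π} ∩ ({S > 4π} ∪ {H₁₂₂ > 2π} ∪ {H₂₁₂ > 2π} ∪ {H₂₂₁ > 2π}), C₄^{c,2} = {H₁₁₁ < 2π}, C₆^c = {H₂₂₂ > 0} ∪ {H₁₁₁ < 6π}, C₈^{c,1} = {H₁₁₁ < 10π} ∩ ({S < 8π} ∪ {H₂₁₁ < 4π} ∪ {H₁₂₁ < 4π} ∪ {H₁₁₂ < 4π}) and C₈^{c,2} = {H₂₂₂ > 4π} (all intersected with 𝒯³), one has: 𝒫_ω ∩ (C₄^{c,1} ∪ C₄^{c,2}) ∩ (𝒯°)³ = ∅, 𝒫₁ ∩ C₆^c ∩ (𝒯°)³ = ∅, and 𝒫_{ω²} ∩ (C₈^{c,1} ∪ C₈^{c,2}) ∩ (𝒯°)³ = ∅. -/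

import Mathlib

open Real Matrix Set

noncomputable section

abbrev Pt : Type := ℝ × ℝ
abbrev Tri : Type := Pt × Pt × Pt

/-- Membership in `𝒯 = {(a₁,a₂) ∈ [0,2π)² : a₁ ≥ a₂}`. -/
def memT (p : Pt) : Prop :=
  0 ≤ p.1 ∧ p.1 < 2 * π ∧ 0 ≤ p.2 ∧ p.2 < 2 * π ∧ p.2 ≤ p.1

def memT3 (τ : Tri) : Prop := memT τ.1 ∧ memT τ.2.1 ∧ memT τ.2.2

/-- Membership in the interior `𝒯° = {(a₁,a₂) : 0 < a₂ < a₁ < 2π}`. -/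
def memTo (p : Pt) : Prop := 0 < p.2 ∧ p.2 < p.1 ∧ p.1 < 2 * π

def memTo3 (τ : Tri) : Prop := memTo τ.1 ∧ memTo τ.2.1 ∧ memTo τ.2.2

/-- The sum `S(τ) = α₁+α₂+β₁+β₂+γ₁+γ₂`. -/
def Sf (τ : Tri) : ℝ := τ.1.1 + τ.1.2 + τ.2.1.1 + τ.2.1.2 + τ.2.2.1 + τ.2.2.2

/-- The coordinate of a pair: index `0` is the first coordinate (subscript 1),
index `1` the second (subscript 2). -/
def coord (p : Pt) (i : Fin 2) : ℝ := if i = 0 then p.1 else p.2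

/-- `sg τ i j k = σ_{(i+1)(j+1)(k+1)}(τ) = α_i + β_j + γ_k` (indices in `Fin 2`,
index `0` ↔ subscript 1, index `1` ↔ subscript 2). -/
def sg (τ : Tri) (i j k : Fin 2) : ℝ := coord τ.1 i + coord τ.2.1 j + coord τ.2.2 k

/-- `Hf τ i j k = 2 σ_{ijk}(τ) − σ_{ī j̄ k̄}(τ)`, the complementary index being `i+1` in `Fin 2`. -/
def Hf (τ : Tri) (i j k : Fin 2) : ℝ := 2 * sg τ i j k - sg τ (i + 1) (j + 1) (k + 1)

abbrev M3 : Type := Matrix (Fin 3) (Fin 3) ℂ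

/-- The form J = diag(1, 1, −1). -/
def J3 : M3 := Matrix.diagonal ![1, 1, -1]

/-- Membership in U(2,1). -/
def memU21 (M : M3) : Prop := Mᴴ * J3 * M = J3

/-- The diagonal matrix E(a₁,a₂) = diag(e^{ia₁}, e^{ia₂}, 1). -/
def Emat (a₁ a₂ : ℝ) : M3 :=
  Matrix.diagonal ![Complex.exp (a₁ * Complex.I), Complex.exp (a₂ * Complex.I), 1]

/-- `M` is of elliptic type `(a₁,a₂)`: conjugate in U(2,1) to E(a₁,a₂). -/
def ellType (M : M3) (a₁ a₂ : ℝ) : Prop :=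
  ∃ P : M3, memU21 P ∧ M = P * Emat a₁ a₂ * P⁻¹

/-- The standard lift L(a₁,a₂) = diag(e^{i(2a₁−a₂)/3}, e^{i(2a₂−a₁)/3}, e^{−i(a₁+a₂)/3}). -/
def Lmat (a₁ a₂ : ℝ) : M3 :=
  Matrix.diagonal ![Complex.exp (((2 * a₁ - a₂) / 3) * Complex.I),
    Complex.exp (((2 * a₂ - a₁) / 3) * Complex.I),
    Complex.exp ((-(a₁ + a₂) / 3) * Complex.I)]

/-- ω = e^{2πi/3}. -/
def omg : ℂ := Complex.exp (2 * π * Complex.I / 3)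

/-- `𝒫ᵤ`: the solution set with standard lifts multiplying to `u·I₃`. -/
def Psol (u : ℂ) : Set Tri := {τ | memT3 τ ∧ ∃ A B C : M3,
  memU21 A ∧ memU21 B ∧ memU21 C ∧
  (∃ P : M3, memU21 P ∧ A = P * Lmat τ.1.1 τ.1.2 * P⁻¹) ∧
  (∃ P : M3, memU21 P ∧ B = P * Lmat τ.2.1.1 τ.2.1.2 * P⁻¹) ∧
  (∃ P : M3, memU21 P ∧ C = P * Lmat τ.2.2.1 τ.2.2.2 * P⁻¹) ∧
  A * B * C = u • (1 : M3)}

/-- The cell C₄^{c,1}. -/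
def C41 : Set Tri := {τ | memT3 τ ∧ -(4 * π) < Hf τ 1 1 1 ∧
  (4 * π < Sf τ ∨ 2 * π < Hf τ 0 1 1 ∨ 2 * π < Hf τ 1 0 1 ∨ 2 * π < Hf τ 1 1 0)}

/-- The cell C₄^{c,2}. -/
def C42 : Set Tri := {τ | memT3 τ ∧ Hf τ 0 0 0 < 2 * π}

/-- The cell C₆^c. -/
def C6c : Set Tri := {τ | memT3 τ ∧ (0 < Hf τ 1 1 1 ∨ Hf τ 0 0 0 < 6 * π)}

/-- The cell C₈^{c,1}. -/
def C81 : Set Tri := {τ | memT3 τ ∧ Hf τ 0 0 0 < 10 * π ∧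
  (Sf τ < 8 * π ∨ Hf τ 1 0 0 < 4 * π ∨ Hf τ 0 1 0 < 4 * π ∨ Hf τ 0 0 1 < 4 * π)}

/-- The cell C₈^{c,2}. -/
def C82 : Set Tri := {τ | memT3 τ ∧ 4 * π < Hf τ 1 1 1}

/-! ### Inertia of nondegenerate Hermitian matrices -/

/-- `Ine H k`: the matrix `H` is congruent to a real invertible diagonal matrix with exactly `k`
negative entries. -/
def Ine {n : Type} [Fintype n] [DecidableEq n] (H : Matrix n n ℂ) (k : ℕ) : Prop :=
  ∃ Q : Matrix n n ℂ, IsUnit Q ∧ ∃ d : n → ℝ, (∀ i, d i ≠ 0) ∧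
    H = Qᴴ * diagonal (fun i => (d i : ℂ)) * Q ∧ (Finset.univ.filter (fun i => d i < 0)).card = k

lemma diag_form_re {n : Type} [Fintype n] [DecidableEq n] (Q : Matrix n n ℂ) (d : n → ℝ)
    (v : n → ℂ) :
    star v ⬝ᵥ ((Qᴴ * diagonal (fun i => (d i : ℂ)) * Q) *ᵥ v) =
      ((∑ i, d i * Complex.normSq ((Q *ᵥ v) i) : ℝ) : ℂ) := by
  rw [← mulVec_mulVec, ← mulVec_mulVec, dotProduct_mulVec, ← star_mulVec]
  simp only [dotProduct, mulVec_diagonal, Pi.star_apply]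
  push_cast
  refine Finset.sum_congr rfl fun i _ => ?_
  rw [Complex.normSq_eq_conj_mul_self]
  simp only [RCLike.star_def]
  ring

lemma ine_le {n : Type} [Fintype n] [DecidableEq n] {H : Matrix n n ℂ} {k l : ℕ}
    (hk : Ine H k) (hl : Ine H l) : k ≤ l := by
  obtain ⟨Q, hQ, d, hd, hH, hc⟩ := hk
  obtain ⟨Q', hQ', d', hd', hH', hc'⟩ := hl
  by_contra hlt
  push Not at hlt
  let N := {i : n // d i < 0}
  let N' := {i : n // d' i < 0}
  have hN : Fintype.card N = k := by rw [Fintype.card_subtype]; exact hc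
  have hN' : Fintype.card N' = l := by rw [Fintype.card_subtype]; exact hc'
  have hQdet : IsUnit Q.det := (isUnit_iff_isUnit_det Q).1 hQ
  let ext : (N → ℂ) →ₗ[ℂ] (n → ℂ) := Function.ExtendByZero.linearMap ℂ (Subtype.val : N → n)
  let f : (N → ℂ) →ₗ[ℂ] (N' → ℂ) :=
    (LinearMap.funLeft ℂ ℂ (Subtype.val : N' → n)) ∘ₗ (Q' * Q⁻¹).mulVecLin ∘ₗ ext
  have hker : LinearMap.ker f ≠ ⊥ := by
    apply LinearMap.ker_ne_bot_of_finrank_lt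
    simp [hN, hN', hlt]
  obtain ⟨w, hw, hw0⟩ := (Submodule.ne_bot_iff _).1 hker
  let v : n → ℂ := Q⁻¹ *ᵥ (ext w)
  have hv1 : Q *ᵥ v = ext w := by
    simp only [v, mulVec_mulVec, mul_nonsing_inv Q hQdet, one_mulVec]
  have hv2 : ∀ i, d' i < 0 → (Q' *ᵥ v) i = 0 := by
    intro i hi
    have := congrFun (LinearMap.mem_ker.1 hw) ⟨i, hi⟩
    simpa [f, v, mulVec_mulVec, LinearMap.funLeft] using this
  have e1 := diag_form_re Q d v
  have e2 := diag_form_re Q' d' v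
  rw [← hH] at e1
  rw [← hH', e1] at e2
  have e3 : (∑ i, d i * Complex.normSq ((Q *ᵥ v) i)) =
      ∑ i, d' i * Complex.normSq ((Q' *ᵥ v) i) := by exact_mod_cast e2
  have hpos : 0 ≤ ∑ i, d' i * Complex.normSq ((Q' *ᵥ v) i) := by
    refine Finset.sum_nonneg fun i _ => ?_
    by_cases hi : d' i < 0
    · simp [hv2 i hi]
    · exact mul_nonneg (not_lt.1 hi) (Complex.normSq_nonneg _)
  have hext : ∀ i, ¬ d i < 0 → ext w i = 0 := by
    intro i hi
    simp only [ext, Function.ExtendByZero.linearMap_apply]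
    rw [Function.extend_apply']
    · rfl
    · rintro ⟨a, rfl⟩; exact hi a.2
  have hext' : ∀ j : N, ext w j.1 = w j := by
    intro j
    simp only [ext, Function.ExtendByZero.linearMap_apply]
    exact Subtype.val_injective.extend_apply _ _ _
  obtain ⟨j, hj⟩ := Function.ne_iff.1 hw0
  have hneg : (∑ i, d i * Complex.normSq ((Q *ᵥ v) i)) < 0 := by
    rw [hv1]
    refine Finset.sum_neg' ?_ ⟨j.1, ?_, ?_⟩
    · intro i _
      by_cases hi : d i < 0
      · exact mul_nonpos_of_nonpos_of_nonneg hi.le (Complex.normSq_nonneg _)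
      · simp [hext i hi]
    · exact Finset.mem_univ _
    · rw [hext']
      exact mul_neg_of_neg_of_pos j.2 (Complex.normSq_pos.2 hj)
  linarith

lemma ine_unique {n : Type} [Fintype n] [DecidableEq n] {H : Matrix n n ℂ} {k l : ℕ}
    (hk : Ine H k) (hl : Ine H l) : k = l := le_antisymm (ine_le hk hl) (ine_le hl hk)

lemma ine_congr {n : Type} [Fintype n] [DecidableEq n] {H : Matrix n n ℂ} {k : ℕ}
    (hk : Ine H k) (P : Matrix n n ℂ) (hP : IsUnit P) : Ine (Pᴴ * H * P) k := by
  obtain ⟨Q, hQ, d, hd, hH, hc⟩ := hk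
  refine ⟨Q * P, hQ.mul hP, d, hd, ?_, hc⟩
  rw [hH, conjTranspose_mul]
  simp only [Matrix.mul_assoc]

lemma ine_exists {n : Type} [Fintype n] [DecidableEq n] {H : Matrix n n ℂ}
    (hH : H.IsHermitian) (hu : IsUnit H) : ∃ k, k ≤ Fintype.card n ∧ Ine H k := by
  refine ⟨_, Finset.card_le_univ (Finset.univ.filter (fun i => hH.eigenvalues i < 0)),
    (hH.eigenvectorUnitary : Matrix n n ℂ)ᴴ, ?_, hH.eigenvalues, ?_, ?_, rfl⟩
  · rw [isUnit_iff_isUnit_det, det_conjTranspose]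
    have : IsUnit (hH.eigenvectorUnitary : Matrix n n ℂ).det := by
      rw [← isUnit_iff_isUnit_det]
      exact (Unitary.toUnits hH.eigenvectorUnitary).isUnit
    exact this.star
  · intro i h0
    have h1 := hH.det_eq_prod_eigenvalues
    have : H.det = 0 := by
      rw [h1]; exact Finset.prod_eq_zero (Finset.mem_univ i) (by simp [h0])
    have h2 := (isUnit_iff_isUnit_det H).1 hu
    rw [this] at h2
    exact not_isUnit_zero h2
  · have := hH.spectral_theorem
    rw [Unitary.conjStarAlgAut_apply] at this
    rw [conjTranspose_conjTranspose]
    exact this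

lemma ine_fromBlocks {m n : Type} [Fintype n] [DecidableEq n] [Fintype m] [DecidableEq m]
    {H : Matrix m m ℂ} {K : Matrix n n ℂ} {k l : ℕ}
    (hk : Ine H k) (hl : Ine K l) : Ine (fromBlocks H 0 0 K) (k + l) := by
  obtain ⟨Q, hQ, d, hd, hH, hc⟩ := hk
  obtain ⟨Q', hQ', d', hd', hH', hc'⟩ := hl
  refine ⟨fromBlocks Q 0 0 Q', ?_, Sum.elim d d', ?_, ?_, ?_⟩
  · rw [isUnit_iff_isUnit_det, det_fromBlocks_zero₁₂]
    exact ((isUnit_iff_isUnit_det Q).1 hQ).mul ((isUnit_iff_isUnit_det Q').1 hQ')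
  · rintro (i | i)
    · exact hd i
    · exact hd' i
  · have : (diagonal fun i => ((Sum.elim d d' i : ℝ) : ℂ)) =
        fromBlocks (diagonal fun i => (d i : ℂ)) 0 0 (diagonal fun i => (d' i : ℂ)) := by
      rw [fromBlocks_diagonal]; congr 1; ext i; cases i <;> rfl
    rw [this, fromBlocks_conjTranspose, fromBlocks_multiply, fromBlocks_multiply]
    simp [hH, hH']
  · rw [← hc, ← hc', Finset.card_filter, Finset.card_filter, Finset.card_filter,
      Fintype.sum_sum_type]
    rfl

lemma schur_count {n : Type} [Fintype n] [DecidableEq n] {A B D : Matrix n n ℂ} {k l k' l' : ℕ}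
    (hA : A.IsHermitian) (hD : D.IsHermitian) (hAu : IsUnit A) (hDu : IsUnit D)
    (h1 : Ine A k) (h2 : Ine (D - Bᴴ * A⁻¹ * B) l)
    (h3 : Ine D k') (h4 : Ine (A - B * D⁻¹ * Bᴴ) l') : k + l = l' + k' := by
  have e1 : Ine (fromBlocks A B Bᴴ D) (k + l) := by
    let := hAu.invertible
    have := ine_congr (ine_fromBlocks h1 h2) (fromBlocks 1 (A⁻¹ * B) 0 1)
      (by rw [isUnit_iff_isUnit_det, det_fromBlocks_zero₂₁]; simp)
    convert this using 1
    rw [fromBlocks_eq_of_invertible₁₁ A B Bᴴ D, fromBlocks_conjTranspose]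
    simp [conjTranspose_mul, conjTranspose_nonsing_inv, hA.eq]
  have e2 : Ine (fromBlocks A B Bᴴ D) (l' + k') := by
    let := hDu.invertible
    have := ine_congr (ine_fromBlocks h4 h3) (fromBlocks 1 0 (D⁻¹ * Bᴴ) 1)
      (by rw [isUnit_iff_isUnit_det, det_fromBlocks_zero₁₂]; simp)
    convert this using 1
    rw [fromBlocks_eq_of_invertible₂₂ A B Bᴴ D, fromBlocks_conjTranspose]
    simp [conjTranspose_mul, conjTranspose_nonsing_inv, hD.eq]
  exact ine_unique e1 e2

/-- the sign of the determinant records the parity of the index -/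
lemma ine_det {n : Type} [Fintype n] [DecidableEq n] {H : Matrix n n ℂ} {k : ℕ}
    (hk : Ine H k) : ∃ r : ℝ, 0 < r ∧ H.det = (((-1) ^ k * r : ℝ) : ℂ) := by
  obtain ⟨Q, hQ, d, hd, hH, hc⟩ := hk
  have hQ0 : Q.det ≠ 0 := ((isUnit_iff_isUnit_det Q).1 hQ).ne_zero
  refine ⟨Complex.normSq Q.det * ∏ i, |d i|, ?_, ?_⟩
  · exact mul_pos (Complex.normSq_pos.2 hQ0) (Finset.prod_pos fun i _ => abs_pos.2 (hd i))
  · have h1 : ∏ i, d i = (-1) ^ k * ∏ i, |d i| := by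
      rw [← hc, ← Finset.prod_const, Finset.prod_filter, ← Finset.prod_mul_distrib]
      refine Finset.prod_congr rfl fun i _ => ?_
      split_ifs with h
      · rw [abs_of_neg h]; ring
      · rw [abs_of_nonneg (not_lt.1 h)]; ring
    rw [hH, det_mul, det_mul, det_conjTranspose, det_diagonal]
    have h2 : (∏ i, ((d i : ℝ) : ℂ)) = (((-1) ^ k * ∏ i, |d i| : ℝ) : ℂ) := by
      rw [← h1]; push_cast; rfl
    rw [h2]
    push_cast
    rw [Complex.normSq_eq_conj_mul_self]
    simp only [RCLike.star_def]
    ring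
/-! ### The Cayley form and the cocycle identity -/

/-- The resolvent at `1`. -/
def RR (A : M3) : M3 := (1 - A)⁻¹

/-- The Hermitian form attached to a pair of isometries. -/
def KK (A B : M3) : M3 := (2 * Complex.I) • (J3 * (RR A + RR B - 1))

lemma J3_herm : J3ᴴ = J3 := by
  unfold J3
  rw [diagonal_conjTranspose]
  congr 1
  ext i
  fin_cases i <;> simp

lemma J3_sq : J3 * J3 = 1 := by
  unfold J3
  rw [diagonal_mul_diagonal, ← diagonal_one]
  congr 1
  ext i
  fin_cases i <;> simp

lemma J3_det : J3.det = -1 := by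
  unfold J3
  rw [det_diagonal, Fin.prod_univ_three]; simp

lemma J3_unit : IsUnit J3 := by
  rw [isUnit_iff_isUnit_det, J3_det]; simp

lemma RR_left {A : M3} (h : IsUnit (1 - A)) : RR A * (1 - A) = 1 :=
  nonsing_inv_mul _ ((isUnit_iff_isUnit_det _).1 h)

lemma RR_right {A : M3} (h : IsUnit (1 - A)) : (1 - A) * RR A = 1 :=
  mul_nonsing_inv _ ((isUnit_iff_isUnit_det _).1 h)

lemma RR_mul {A : M3} (h : IsUnit (1 - A)) : RR A * A = RR A - 1 := by
  have := RR_left h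
  rw [mul_sub, mul_one] at this
  rw [← this]; abel

lemma RR_unit {A : M3} (h : IsUnit (1 - A)) : IsUnit (RR A) :=
  IsUnit.of_mul_eq_one _ (RR_left h)

lemma RR_herm {A : M3} (hA : memU21 A) (h : IsUnit (1 - A)) :
    (RR A)ᴴ * J3 = J3 - J3 * RR A := by
  have h1 := RR_right h
  have h2 : (RR A)ᴴ * (1 - A)ᴴ = 1 := by rw [← conjTranspose_mul, h1, conjTranspose_one]
  have h3 : (1 - A)ᴴ * J3 * (1 - A) = J3 * (1 - A) + (1 - A)ᴴ * J3 := by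
    have hA' : Aᴴ * J3 * A = J3 := hA
    rw [conjTranspose_sub, conjTranspose_one]
    calc (1 - Aᴴ) * J3 * (1 - A) = J3 - J3 * A - Aᴴ * J3 + Aᴴ * J3 * A := by noncomm_ring
      _ = J3 - J3 * A - Aᴴ * J3 + J3 := by rw [hA']
      _ = _ := by noncomm_ring
  have h4 : (RR A)ᴴ * ((1 - A)ᴴ * J3 * (1 - A)) * RR A = J3 := by
    calc (RR A)ᴴ * ((1 - A)ᴴ * J3 * (1 - A)) * RR A
        = ((RR A)ᴴ * (1 - A)ᴴ) * J3 * ((1 - A) * RR A) := by simp only [Matrix.mul_assoc]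
      _ = J3 := by rw [h1, h2]; simp
  rw [h3] at h4
  have h5 : (RR A)ᴴ * (J3 * (1 - A) + (1 - A)ᴴ * J3) * RR A
      = (RR A)ᴴ * J3 * ((1 - A) * RR A) + ((RR A)ᴴ * (1 - A)ᴴ) * J3 * RR A := by
    simp only [Matrix.mul_assoc, Matrix.mul_add, Matrix.add_mul]
  rw [h5, h1, h2] at h4
  simp only [mul_one, one_mul] at h4
  rw [eq_sub_iff_add_eq]; exact h4

lemma two_I_star : star (2 * Complex.I) = -(2 * Complex.I) := by
  simp

lemma KK_herm {A B : M3} (hA : memU21 A) (hB : memU21 B) (h : IsUnit (1 - A))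
    (h' : IsUnit (1 - B)) : (KK A B).IsHermitian := by
  unfold KK Matrix.IsHermitian
  rw [conjTranspose_smul, conjTranspose_mul, J3_herm, two_I_star, neg_smul, ← smul_neg]
  congr 1
  rw [conjTranspose_sub, conjTranspose_add, conjTranspose_one, sub_mul, add_mul, RR_herm hA h,
    RR_herm hB h']
  noncomm_ring

lemma KK_comm (A B : M3) : KK A B = KK B A := by
  unfold KK; rw [add_comm]

lemma RR_sum {A B : M3} (h : IsUnit (1 - A)) (h' : IsUnit (1 - B)) :
    RR A + RR B - 1 = RR B * (1 - B * A) * RR A := by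
  have h1 := RR_right h
  have h2 := RR_mul h'
  have h3 : (1 - B * A) = (1 - B) + B * (1 - A) := by noncomm_ring
  rw [h3, mul_add, add_mul, RR_left h', one_mul, ← Matrix.mul_assoc, h2, Matrix.mul_assoc, h1,
    mul_one]
  abel

lemma two_I_unit : IsUnit (2 * Complex.I) := by
  simp

lemma KK_unit {A B : M3} (h : IsUnit (1 - A)) (h' : IsUnit (1 - B)) (h'' : IsUnit (1 - B * A)) :
    IsUnit (KK A B) := by
  unfold KK
  rw [RR_sum h h']
  have : IsUnit (J3 * (RR B * (1 - B * A) * RR A)) :=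
    J3_unit.mul (((RR_unit h').mul h'').mul (RR_unit h))
  rw [isUnit_iff_isUnit_det, det_smul]
  exact (two_I_unit.pow _).mul ((isUnit_iff_isUnit_det _).1 this)

lemma memU21_smul {A : M3} (hA : memU21 A) {ξ : ℂ} (hξ : star ξ * ξ = 1) : memU21 (ξ • A) := by
  unfold memU21 at *
  rw [conjTranspose_smul, smul_mul_assoc, smul_mul_assoc, mul_smul_comm, hA, smul_smul, hξ,
    one_smul]

lemma memU21_one : memU21 1 := by simp [memU21]

lemma RR_scalar {ξ : ℂ} (hξ : ξ ≠ 1) : RR (ξ • (1 : M3)) = (1 - ξ)⁻¹ • (1 : M3) := by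
  unfold RR
  apply inv_eq_right_inv
  rw [mul_smul_comm, mul_one]
  have h1 : (1 : ℂ) - ξ ≠ 0 := sub_ne_zero.2 hξ.symm
  have : (1 : M3) - ξ • 1 = (1 - ξ) • 1 := by rw [sub_smul, one_smul]
  rw [this, smul_smul, inv_mul_cancel₀ h1, one_smul]

lemma scalar_unit {ξ : ℂ} (hξ : ξ ≠ 1) : IsUnit (1 - ξ • (1 : M3)) := by
  have h1 : (1 : ℂ) - ξ ≠ 0 := sub_ne_zero.2 hξ.symm
  have : (1 : M3) - ξ • 1 = (1 - ξ) • 1 := by rw [sub_smul, one_smul]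
  rw [this, isUnit_iff_isUnit_det, det_smul]
  simp [h1]

lemma cocycle {A B : M3} {ξ : ℂ} (hA : memU21 A) (hB : memU21 B) (hξ : star ξ * ξ = 1)
    (hξ1 : ξ ≠ 1) (uA : IsUnit (1 - A)) (uB : IsUnit (1 - B)) (uBA : IsUnit (1 - B * A))
    (uξA : IsUnit (1 - ξ • A)) {k l k' l' : ℕ}
    (h1 : Ine (KK (ξ • 1) A) k) (h2 : Ine (KK (ξ • A) B) l)
    (h3 : Ine (KK A B) k') (h4 : Ine (KK (ξ • 1) (B * A)) l') : k + l = l' + k' := by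
  have uξ := scalar_unit hξ1
  have mξ : memU21 (ξ • (1 : M3)) := memU21_smul memU21_one hξ
  have hc : (1 : ℂ) - ξ ≠ 0 := sub_ne_zero.2 hξ1.symm
  have hU1 : IsUnit (KK (ξ • 1) A) := by
    rw [KK_comm]
    refine KK_unit uA uξ ?_
    rw [smul_mul_assoc, one_mul]; exact uξA
  have hU2 : IsUnit (KK A B) := KK_unit uA uB uBA
  have hBt : ((2 * Complex.I) • (J3 * RR A))ᴴ = (2 * Complex.I) • (J3 * (RR A - 1)) := by
    rw [conjTranspose_smul, conjTranspose_mul, J3_herm, two_I_star, neg_smul, ← smul_neg,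
      RR_herm hA uA]
    congr 1; noncomm_ring
  -- first Schur complement
  have e1 : RR A = (1 + (1 - ξ) • (RR A - 1)) * RR (ξ • A) := by
    have : RR A * (1 - ξ • A) = 1 + (1 - ξ) • (RR A - 1) := by
      rw [mul_sub, mul_one, mul_smul_comm, RR_mul uA]
      module
    rw [← this, Matrix.mul_assoc, RR_right uξA, mul_one]
  have e2 : (2 * Complex.I) • (J3 * RR A) = KK (ξ • 1) A * ((1 - ξ) • RR (ξ • A)) := by
    unfold KK
    rw [RR_scalar hξ1, smul_mul_assoc, Matrix.mul_assoc]
    congr 2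
    rw [mul_smul_comm, ← smul_mul_assoc]
    conv_lhs => rw [e1]
    congr 1
    rw [smul_sub (1 - ξ) ((1 - ξ)⁻¹ • (1 : M3) + RR A), smul_add, smul_smul, mul_inv_cancel₀ hc]
    module
  have e3 : KK A B - ((2 * Complex.I) • (J3 * RR A))ᴴ * (KK (ξ • 1) A)⁻¹ *
      ((2 * Complex.I) • (J3 * RR A)) = KK (ξ • A) B := by
    rw [Matrix.mul_assoc, hBt]
    conv_lhs => rw [e2]
    rw [nonsing_inv_mul_cancel_left _ _ ((isUnit_iff_isUnit_det _).1 hU1)]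
    unfold KK
    rw [smul_mul_assoc, Matrix.mul_assoc, ← smul_sub, ← mul_sub]
    congr 2
    have : RR A - (RR A - 1) * (1 - ξ) • RR (ξ • A) = RR (ξ • A) := by
      conv_lhs => enter [1]; rw [e1]
      rw [add_mul, one_mul, smul_mul_assoc, mul_smul_comm]
      abel
    conv_rhs => rw [← this]
    abel
  -- second Schur complement
  have f0 : RR B = (1 + (RR B - 1) * (1 - A)) * RR (B * A) := by
    have : RR B * (1 - B * A) = 1 + (RR B - 1) * (1 - A) := by
      rw [mul_sub, mul_one, ← Matrix.mul_assoc, RR_mul uB]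
      noncomm_ring
    rw [← this, Matrix.mul_assoc, RR_right uBA, mul_one]
  have f1 : (2 * Complex.I) • (J3 * (RR A - 1)) = KK A B * (1 - (1 - A) * RR (B * A)) := by
    unfold KK
    rw [smul_mul_assoc, Matrix.mul_assoc]
    congr 2
    have g1 : (RR A + RR B - 1) * (1 - (1 - A) * RR (B * A)) = RR A + RR B - 1
        - (RR A * (1 - A)) * RR (B * A) - (RR B - 1) * (1 - A) * RR (B * A) := by noncomm_ring
    rw [g1, RR_left uA]
    have g2 : RR B = RR (B * A) + (RR B - 1) * (1 - A) * RR (B * A) := by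
      conv_lhs => rw [f0]
      rw [add_mul, one_mul]
    conv_rhs => enter [1, 1, 1, 2]; rw [g2]
    rw [one_mul]
    abel
  have f3 : KK (ξ • 1) A - ((2 * Complex.I) • (J3 * RR A)) * (KK A B)⁻¹ *
      ((2 * Complex.I) • (J3 * RR A))ᴴ = KK (ξ • 1) (B * A) := by
    rw [Matrix.mul_assoc, hBt, f1,
      nonsing_inv_mul_cancel_left _ _ ((isUnit_iff_isUnit_det _).1 hU2)]
    unfold KK
    rw [smul_mul_assoc, Matrix.mul_assoc, ← smul_sub, ← mul_sub]
    congr 2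
    rw [mul_sub, mul_one, ← Matrix.mul_assoc, RR_left uA, one_mul]
    abel
  refine schur_count (KK_herm mξ hA uξ uA) (KK_herm hA hB uA uB) hU1 hU2 h1 ?_ h3 ?_
    (B := (2 * Complex.I) • (J3 * RR A))
  · rw [e3]; exact h2
  · rw [f3]; exact h4
/-! ### Elliptic matrices with prescribed angles (in units of `2π`) -/

/-- `ex t = e^{2πit}`. -/
def ex (t : ℝ) : ℂ := Complex.exp (2 * π * t * Complex.I)

/-- `hx t = e^{πit}`. -/
def hx (t : ℝ) : ℂ := Complex.exp (π * t * Complex.I)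

lemma ex_add (s t : ℝ) : ex (s + t) = ex s * ex t := by
  unfold ex; rw [← Complex.exp_add]; congr 1; push_cast; ring

lemma hx_add (s t : ℝ) : hx (s + t) = hx s * hx t := by
  unfold hx; rw [← Complex.exp_add]; congr 1; push_cast; ring

lemma ex_zero : ex 0 = 1 := by simp [ex]

lemma hx_ne (t : ℝ) : hx t ≠ 0 := Complex.exp_ne_zero _

lemma ex_neg (t : ℝ) : ex (-t) * ex t = 1 := by
  rw [← ex_add]; simp [ex]

lemma ex_star (t : ℝ) : star (ex t) * ex t = 1 := by
  rw [← ex_neg t]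
  congr 1
  unfold ex
  rw [RCLike.star_def, ← Complex.exp_conj]
  congr 1
  simp only [map_mul, Complex.conj_ofReal, Complex.conj_I, map_ofNat, Complex.ofReal_neg]
  ring

/-- not an integer -/
def NI (t : ℝ) : Prop := ∀ n : ℤ, t ≠ n

lemma NI.neg {t : ℝ} (h : NI t) : NI (-t) := by
  intro n hn
  exact h (-n) (by push_cast; linarith)

lemma NI.floor_lt {t : ℝ} (h : NI t) : (⌊t⌋ : ℝ) < t :=
  lt_of_le_of_ne (Int.floor_le t) (h _).symm

lemma NI.floor_neg {t : ℝ} (h : NI t) : ⌊-t⌋ = -⌊t⌋ - 1 := by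
  rw [Int.floor_eq_iff]
  have h1 := h.floor_lt
  have h2 := Int.lt_floor_add_one t
  push_cast
  constructor <;> linarith

lemma NI.sin_sign {t : ℝ} (h : NI t) : ∃ r : ℝ, 0 < r ∧ Real.sin (π * t) = (-1) ^ ⌊t⌋ * r := by
  refine ⟨Real.sin (π * Int.fract t), ?_, ?_⟩
  · have h1 : 0 < Int.fract t := Int.fract_pos.2 (h _)
    have h2 := Int.fract_lt_one t
    apply Real.sin_pos_of_pos_of_lt_pi
    · exact mul_pos Real.pi_pos h1
    · nlinarith [Real.pi_pos]
  · have : π * t = π * Int.fract t + ⌊t⌋ * π := by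
      rw [Int.fract]; ring
    rw [this, Real.sin_add_int_mul_pi]

lemma NI.sin_ne {t : ℝ} (h : NI t) : Real.sin (π * t) ≠ 0 := by
  obtain ⟨r, hr, e⟩ := h.sin_sign
  rw [e]
  exact mul_ne_zero (zpow_ne_zero _ (by norm_num)) hr.ne'

lemma one_sub_ex (t : ℝ) : 1 - ex t = -2 * Complex.I * (Real.sin (π * t) : ℝ) * hx t := by
  have h1 : ex t = hx t * hx t := by
    unfold ex hx; rw [← Complex.exp_add]; congr 1; ring
  have h2 : hx (-t) * hx t = 1 := by rw [← hx_add]; simp [hx]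
  have h3 : ((Real.sin (π * t) : ℝ) : ℂ) = (hx (-t) - hx t) * Complex.I / 2 := by
    push_cast
    rw [Complex.sin]
    unfold hx
    congr 4
    push_cast
    ring_nf
  rw [h3, h1]
  linear_combination (-1 : ℂ) * h2 + (hx (-t) * hx t - hx t * hx t) * Complex.I_sq

lemma NI.ex_ne {t : ℝ} (h : NI t) : 1 - ex t ≠ 0 := by
  rw [one_sub_ex]
  refine mul_ne_zero (mul_ne_zero (by simp) ?_) (hx_ne t)
  exact_mod_cast h.sin_ne

/-- `M` is elliptic with angles `2π t`; the last one is of negative type. -/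
def Ell (M : M3) (t : Fin 3 → ℝ) : Prop :=
  ∃ P : M3, memU21 P ∧ M = P * diagonal (fun k => ex (t k)) * P⁻¹

lemma memU21_unit {P : M3} (h : memU21 P) : IsUnit P := by
  have : (J3 * Pᴴ * J3) * P = 1 := by
    rw [Matrix.mul_assoc, Matrix.mul_assoc, ← Matrix.mul_assoc Pᴴ, h, J3_sq]
  exact IsUnit.of_mul_eq_one _ (mul_eq_one_comm.1 this)

lemma memU21_inv_mul {P : M3} (h : memU21 P) : P⁻¹ * P = 1 :=
  nonsing_inv_mul _ ((isUnit_iff_isUnit_det _).1 (memU21_unit h))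

lemma memU21_mul_inv {P : M3} (h : memU21 P) : P * P⁻¹ = 1 :=
  mul_nonsing_inv _ ((isUnit_iff_isUnit_det _).1 (memU21_unit h))

lemma memU21_mul {P Q : M3} (h : memU21 P) (h' : memU21 Q) : memU21 (P * Q) := by
  unfold memU21 at *
  calc (P * Q)ᴴ * J3 * (P * Q) = Qᴴ * (Pᴴ * J3 * P) * Q := by
        rw [conjTranspose_mul]; simp only [Matrix.mul_assoc]
    _ = J3 := by rw [h, h']

lemma memU21_J {P : M3} (h : memU21 P) : J3 * P = (P⁻¹)ᴴ * J3 := by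
  have h1 := memU21_mul_inv h
  have h2 : (P⁻¹)ᴴ * Pᴴ = 1 := by rw [← conjTranspose_mul, h1, conjTranspose_one]
  calc J3 * P = ((P⁻¹)ᴴ * Pᴴ) * J3 * P := by rw [h2, one_mul]
    _ = (P⁻¹)ᴴ * (Pᴴ * J3 * P) := by simp only [Matrix.mul_assoc]
    _ = _ := by rw [h]

lemma memU21_inv {P : M3} (h : memU21 P) : memU21 P⁻¹ := by
  unfold memU21
  rw [← memU21_J h, Matrix.mul_assoc, memU21_mul_inv h, mul_one]

lemma memU21_diag (t : Fin 3 → ℝ) : memU21 (diagonal (fun k => ex (t k))) := by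
  unfold memU21 J3
  rw [diagonal_conjTranspose, diagonal_mul_diagonal, diagonal_mul_diagonal]
  congr 1
  ext k
  rw [Pi.star_apply, mul_right_comm, ex_star, one_mul]

lemma Ell.mem {M : M3} {t : Fin 3 → ℝ} (h : Ell M t) : memU21 M := by
  obtain ⟨P, hP, rfl⟩ := h
  exact memU21_mul (memU21_mul hP (memU21_diag t)) (memU21_inv hP)

lemma Ell.smul {M : M3} {t : Fin 3 → ℝ} (h : Ell M t) (x : ℝ) :
    Ell (ex x • M) (fun k => t k + x) := by
  obtain ⟨P, hP, rfl⟩ := h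
  refine ⟨P, hP, ?_⟩
  have : (diagonal fun k => ex (t k + x)) = ex x • diagonal (fun k => ex (t k)) := by
    rw [← diagonal_smul]
    congr 1
    ext k
    rw [ex_add, mul_comm]; rfl
  rw [this, mul_smul_comm, smul_mul_assoc]

lemma Ell.comm {A B : M3} {t : Fin 3 → ℝ} (h : Ell (A * B) t) (hB : memU21 B) :
    Ell (B * A) t := by
  obtain ⟨P, hP, e⟩ := h
  refine ⟨B * P, memU21_mul hB hP, ?_⟩
  rw [Matrix.mul_inv_rev]
  calc B * A = B * (A * B) * B⁻¹ := by
        simp only [Matrix.mul_assoc]; rw [memU21_mul_inv hB, mul_one]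
    _ = _ := by rw [e]; simp only [Matrix.mul_assoc]

lemma Ell.inv {A C : M3} {t : Fin 3 → ℝ} (h : Ell C t) (e : A * C = 1) :
    Ell A (fun k => - t k) := by
  obtain ⟨P, hP, rfl⟩ := h
  refine ⟨P, hP, ?_⟩
  have h1 : (P * diagonal (fun k => ex (t k)) * P⁻¹) * (P * diagonal (fun k => ex (-t k)) * P⁻¹)
      = 1 := by
    calc _ = P * diagonal (fun k => ex (t k)) * (P⁻¹ * P) * diagonal (fun k => ex (-t k)) * P⁻¹ := by
          simp only [Matrix.mul_assoc]
      _ = P * (diagonal (fun k => ex (t k)) * diagonal (fun k => ex (-t k))) * P⁻¹ := by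
          rw [memU21_inv_mul hP, mul_one]; simp only [Matrix.mul_assoc]
      _ = 1 := by
          rw [diagonal_mul_diagonal]
          have : (fun i => ex (t i) * ex (-t i)) = fun _ => (1 : ℂ) := by
            ext i; rw [mul_comm, ex_neg]
          rw [this, diagonal_one, mul_one, memU21_mul_inv hP]
  calc A = A * ((P * diagonal (fun k => ex (t k)) * P⁻¹) *
        (P * diagonal (fun k => ex (-t k)) * P⁻¹)) := by rw [h1, mul_one]
    _ = _ := by rw [← Matrix.mul_assoc, e, one_mul]

lemma Ell.one_sub {M P : M3} {t : Fin 3 → ℝ} (hP : memU21 P)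
    (e : M = P * diagonal (fun k => ex (t k)) * P⁻¹) :
    1 - M = P * diagonal (fun k => 1 - ex (t k)) * P⁻¹ := by
  have : (diagonal fun k => 1 - ex (t k)) = 1 - diagonal (fun k => ex (t k)) := by
    rw [← diagonal_one, diagonal_sub]
  rw [this, mul_sub, sub_mul, mul_one, memU21_mul_inv hP, e]

lemma Ell.det {M : M3} {t : Fin 3 → ℝ} (h : Ell M t) : (1 - M).det = ∏ k, (1 - ex (t k)) := by
  obtain ⟨P, hP, e⟩ := h
  rw [Ell.one_sub hP e, det_mul, det_mul, det_diagonal, mul_right_comm, ← det_mul,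
    memU21_mul_inv hP, det_one, one_mul]

lemma Ell.unit {M : M3} {t : Fin 3 → ℝ} (h : Ell M t) (ht : ∀ k, NI (t k)) : IsUnit (1 - M) := by
  rw [isUnit_iff_isUnit_det, h.det, isUnit_iff_ne_zero]
  exact Finset.prod_ne_zero_iff.2 fun k _ => (ht k).ex_ne

lemma Ell.RR {M P : M3} {t : Fin 3 → ℝ} (hP : memU21 P)
    (e : M = P * diagonal (fun k => ex (t k)) * P⁻¹) (ht : ∀ k, NI (t k)) :
    RR M = P * diagonal (fun k => (1 - ex (t k))⁻¹) * P⁻¹ := by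
  unfold _root_.RR
  apply inv_eq_right_inv
  rw [Ell.one_sub hP e]
  calc _ = P * diagonal (fun k => 1 - ex (t k)) * (P⁻¹ * P) *
        diagonal (fun k => (1 - ex (t k))⁻¹) * P⁻¹ := by simp only [Matrix.mul_assoc]
    _ = P * (diagonal (fun k => 1 - ex (t k)) * diagonal (fun k => (1 - ex (t k))⁻¹)) * P⁻¹ := by
        rw [memU21_inv_mul hP, mul_one]; simp only [Matrix.mul_assoc]
    _ = 1 := by
        rw [diagonal_mul_diagonal]
        have : (fun i => (1 - ex (t i)) * (1 - ex (t i))⁻¹) = fun _ => (1 : ℂ) := by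
          ext i; exact mul_inv_cancel₀ (ht i).ex_ne
        rw [this, diagonal_one, mul_one, memU21_mul_inv hP]

/-- signed sum of floors -/
def GG (t : Fin 3 → ℝ) : ℤ := ⌊t 0⌋ + ⌊t 1⌋ - ⌊t 2⌋

lemma cot_identity {x t : ℝ} (hx' : NI x) (ht : NI t) :
    2 * Complex.I * ((1 - ex x)⁻¹ + (1 - ex t)⁻¹ - 1) =
      ((-(Real.sin (π * (x + t)) / (Real.sin (π * x) * Real.sin (π * t))) : ℝ) : ℂ) := by
  have e1 : (1 - ex x)⁻¹ + (1 - ex t)⁻¹ - 1 = (1 - ex (x + t)) / ((1 - ex x) * (1 - ex t)) := by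
    have := hx'.ex_ne
    have := ht.ex_ne
    rw [ex_add]
    field_simp
    ring
  rw [e1, one_sub_ex, one_sub_ex, one_sub_ex, hx_add]
  have h1 : ((Real.sin (π * x) : ℝ) : ℂ) ≠ 0 := by exact_mod_cast hx'.sin_ne
  have h2 : ((Real.sin (π * t) : ℝ) : ℂ) ≠ 0 := by exact_mod_cast ht.sin_ne
  have h3 := hx_ne x
  have h4 := hx_ne t
  rw [Complex.ofReal_neg, Complex.ofReal_div, Complex.ofReal_mul]
  generalize ((Real.sin (π * x) : ℝ) : ℂ) = s1 at *
  generalize ((Real.sin (π * t) : ℝ) : ℂ) = s2 at *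
  generalize ((Real.sin (π * (x + t)) : ℝ) : ℂ) = s3 at *
  have hI := Complex.I_ne_zero
  field_simp

lemma cot_sign {x t : ℝ} (hx' : NI x) (ht : NI t) (hxt : NI (x + t)) :
    (⌊t + x⌋ - ⌊t⌋ - ⌊x⌋ = 0 ∧
      -(Real.sin (π * (x + t)) / (Real.sin (π * x) * Real.sin (π * t))) < 0) ∨
    (⌊t + x⌋ - ⌊t⌋ - ⌊x⌋ = 1 ∧
      0 < -(Real.sin (π * (x + t)) / (Real.sin (π * x) * Real.sin (π * t)))) := by
  obtain ⟨r1, p1, e1⟩ := hx'.sin_sign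
  obtain ⟨r2, p2, e2⟩ := ht.sin_sign
  obtain ⟨r3, p3, e3⟩ := hxt.sin_sign
  have hd : ⌊x + t⌋ = ⌊x⌋ + ⌊t⌋ ∨ ⌊x + t⌋ = ⌊x⌋ + ⌊t⌋ + 1 := by
    have a1 := Int.le_floor_add x t
    have a2 := Int.le_floor_add_floor x t
    omega
  have hn : ∀ n : ℤ, ((-1 : ℝ)) ^ n ≠ 0 := fun n => zpow_ne_zero _ (by norm_num)
  rw [add_comm t x]
  have key : ∀ r : ℝ, ((-1 : ℝ) ^ (⌊x⌋ + ⌊t⌋) * r) / ((-1) ^ ⌊x⌋ * r1 * ((-1) ^ ⌊t⌋ * r2)) =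
      r / (r1 * r2) := by
    intro r
    rw [zpow_add₀ (by norm_num)]
    have := hn ⌊x⌋
    have := hn ⌊t⌋
    field_simp
  rcases hd with hd | hd
  · left
    refine ⟨by omega, ?_⟩
    rw [e1, e2, e3, hd, key]
    have : 0 < r3 / (r1 * r2) := by positivity
    linarith
  · right
    refine ⟨by omega, ?_⟩
    rw [e1, e2, e3, hd, zpow_add₀ (by norm_num) _ 1, zpow_one, mul_assoc _ (-1 : ℝ), key]
    have : 0 < r3 / (r1 * r2) := by positivity
    have h2 : (-1 * r3) / (r1 * r2) = -(r3 / (r1 * r2)) := by ring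
    rw [h2]
    linarith

/-- the index of the form attached to a scalar and an elliptic matrix -/
lemma Ell.scalar_index {A : M3} {t : Fin 3 → ℝ} (h : Ell A t) {x : ℝ} (hx' : NI x)
    (ht : ∀ k, NI (t k)) (hxt : ∀ k, NI (x + t k)) :
    ∃ k : ℕ, Ine (KK (ex x • 1) A) k ∧
      (k : ℤ) = 2 - (GG (fun k => t k + x) - GG t - ⌊x⌋) := by
  obtain ⟨P, hP, e⟩ := h
  have hx1 : ex x ≠ 1 := fun h => hx'.ex_ne (by rw [h, sub_self])
  let c : Fin 3 → ℝ := fun k =>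
    -(Real.sin (π * (x + t k)) / (Real.sin (π * x) * Real.sin (π * t k)))
  have hc : ∀ k, c k ≠ 0 := by
    intro k
    rcases cot_sign hx' (ht k) (hxt k) with h | h
    · exact h.2.ne
    · exact h.2.ne'
  let d : Fin 3 → ℝ := ![c 0, c 1, -c 2]
  refine ⟨_, ⟨P⁻¹, memU21_unit (memU21_inv hP), d, ?_, ?_, rfl⟩, ?_⟩
  · intro k
    fin_cases k
    · exact hc 0
    · exact hc 1
    · exact neg_ne_zero.2 (hc 2)
  · have hd : (diagonal fun i => ((d i : ℝ) : ℂ)) = (2 * Complex.I) • (J3 * (diagonal fun k =>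
        ((1 - ex x)⁻¹ + (1 - ex (t k))⁻¹ - 1))) := by
      unfold J3
      rw [diagonal_mul_diagonal, ← diagonal_smul]
      congr 1
      ext k
      have := cot_identity hx' (ht k)
      rw [Pi.smul_apply, smul_eq_mul, mul_left_comm, this]
      fin_cases k <;> simp [d, c]
    have hs : (diagonal fun k => ((1 - ex x)⁻¹ + (1 - ex (t k))⁻¹ - 1)) =
        (1 - ex x)⁻¹ • (1 : M3) + diagonal (fun k => (1 - ex (t k))⁻¹) - 1 := by
      rw [← diagonal_one, ← diagonal_smul, diagonal_add, diagonal_sub]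
      congr 1
      ext k
      simp
    unfold KK
    rw [RR_scalar hx1, Ell.RR hP e ht, hd, mul_smul_comm, smul_mul_assoc, 
      ← Matrix.mul_assoc (P⁻¹)ᴴ J3, ← memU21_J hP, hs, Matrix.mul_assoc J3 P, Matrix.mul_assoc J3]
    congr 2
    rw [mul_sub, mul_add, sub_mul, add_mul, mul_one, memU21_mul_inv hP,
      mul_smul_comm, mul_one, smul_mul_assoc, memU21_mul_inv hP]
  · have h0 := cot_sign hx' (ht 0) (hxt 0)
    have h1 := cot_sign hx' (ht 1) (hxt 1)
    have h2 := cot_sign hx' (ht 2) (hxt 2)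
    change _ ∧ c 0 < 0 ∨ _ ∧ 0 < c 0 at h0
    change _ ∧ c 1 < 0 ∨ _ ∧ 0 < c 1 at h1
    change _ ∧ c 2 < 0 ∨ _ ∧ 0 < c 2 at h2
    have q0 : ((if d 0 < 0 then 1 else 0 : ℕ) : ℤ) = 1 - (⌊t 0 + x⌋ - ⌊t 0⌋ - ⌊x⌋) := by
      rcases h0 with ⟨a, b⟩ | ⟨a, b⟩
      · rw [if_pos (by simpa [d] using b)]; push_cast; omega
      · rw [if_neg (by simpa [d] using b.le)]; push_cast; omega
    have q1 : ((if d 1 < 0 then 1 else 0 : ℕ) : ℤ) = 1 - (⌊t 1 + x⌋ - ⌊t 1⌋ - ⌊x⌋) := by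
      rcases h1 with ⟨a, b⟩ | ⟨a, b⟩
      · rw [if_pos (by simpa [d] using b)]; push_cast; omega
      · rw [if_neg (by simpa [d] using b.le)]; push_cast; omega
    have q2 : ((if d 2 < 0 then 1 else 0 : ℕ) : ℤ) = (⌊t 2 + x⌋ - ⌊t 2⌋ - ⌊x⌋) := by
      rcases h2 with ⟨a, b⟩ | ⟨a, b⟩
      · rw [if_neg (by simpa [d] using b.le)]; push_cast; omega
      · rw [if_pos (by simpa [d] using b)]; push_cast; omega
    rw [Finset.card_filter, Fin.sum_univ_three, Nat.cast_add, Nat.cast_add, q0, q1, q2]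
    unfold GG
    ring
/-! ### The index theorem -/

lemma GG_neg {t : Fin 3 → ℝ} (h : ∀ k, NI (t k)) : GG (fun k => -t k) = -GG t - 1 := by
  unfold GG
  rw [(h 0).floor_neg, (h 1).floor_neg, (h 2).floor_neg]; ring

lemma KK_exists {A B : M3} {t s w : Fin 3 → ℝ} (hA : Ell A t) (hB : Ell B s) (hBA : Ell (B * A) w)
    (ht : ∀ k, NI (t k)) (hs : ∀ k, NI (s k)) (hw : ∀ k, NI (w k)) :
    ∃ k : ℕ, k ≤ 3 ∧ Ine (KK A B) k := by
  have := ine_exists (KK_herm hA.mem hB.mem (hA.unit ht) (hB.unit hs))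
    (KK_unit (hA.unit ht) (hB.unit hs) (hBA.unit hw))
  simpa using this

lemma step {A B : M3} {t s w : Fin 3 → ℝ} (hA : Ell A t) (hB : Ell B s) (hBA : Ell (B * A) w)
    (ht : ∀ k, NI (t k)) (hs : ∀ k, NI (s k)) (hw : ∀ k, NI (w k)) {x : ℝ} (hx' : NI x)
    (htx : ∀ k, NI (t k + x)) (hwx : ∀ k, NI (w k + x)) {k k' : ℕ}
    (h : Ine (KK A B) k) (h' : Ine (KK (ex x • A) B) k') :
    (k' : ℤ) - k = GG (fun k => t k + x) - GG t - (GG (fun k => w k + x) - GG w) := by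
  obtain ⟨k1, i1, e1⟩ := hA.scalar_index hx' ht (fun k => by rw [add_comm]; exact htx k)
  obtain ⟨k2, i2, e2⟩ := hBA.scalar_index hx' hw (fun k => by rw [add_comm]; exact hwx k)
  have hx1 : ex x ≠ 1 := fun h => hx'.ex_ne (by rw [h, sub_self])
  have := cocycle hA.mem hB.mem (ex_star x) hx1 (hA.unit ht) (hB.unit hs) (hBA.unit hw)
    ((hA.smul x).unit htx) i1 h' h i2
  omega

lemma prod_one_sub_ex (t : Fin 3 → ℝ) : ∏ k, (1 - ex (t k)) = (-2 * Complex.I) ^ 3 *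
    ((Real.sin (π * t 0) * Real.sin (π * t 1) * Real.sin (π * t 2) : ℝ) : ℂ) *
    hx (t 0 + t 1 + t 2) := by
  rw [Fin.prod_univ_three, one_sub_ex, one_sub_ex, one_sub_ex, hx_add, hx_add]
  push_cast
  ring

lemma sin_prod_sign {t : Fin 3 → ℝ} (h : ∀ k, NI (t k)) : ∃ r : ℝ, 0 < r ∧
    Real.sin (π * t 0) * Real.sin (π * t 1) * Real.sin (π * t 2) =
      (-1) ^ (⌊t 0⌋ + ⌊t 1⌋ + ⌊t 2⌋) * r := by
  obtain ⟨r1, p1, e1⟩ := (h 0).sin_sign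
  obtain ⟨r2, p2, e2⟩ := (h 1).sin_sign
  obtain ⟨r3, p3, e3⟩ := (h 2).sin_sign
  refine ⟨r1 * r2 * r3, by positivity, ?_⟩
  rw [e1, e2, e3, zpow_add₀ (by norm_num), zpow_add₀ (by norm_num)]
  ring

lemma hx_int (j : ℤ) : hx j = (((-1 : ℝ) ^ j : ℝ) : ℂ) := by
  unfold hx
  have : (π : ℂ) * ((j : ℝ) : ℂ) * Complex.I = j * (π * Complex.I) := by push_cast; ring
  rw [this, Complex.exp_int_mul, Complex.exp_pi_mul_I]
  push_cast; rfl

lemma sign_even {n k : ℤ} {r r' : ℝ} (hr : 0 < r) (hr' : 0 < r')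
    (h : (-1 : ℝ) ^ n * r = (-1) ^ k * r') : Even (n + k) := by
  rcases Int.even_or_odd n with hn | hn <;> rcases Int.even_or_odd k with hk | hk
  · exact hn.add hk
  · rw [hn.neg_one_zpow, hk.neg_one_zpow] at h; linarith
  · rw [hn.neg_one_zpow, hk.neg_one_zpow] at h; linarith
  · exact hn.add_odd hk

lemma parity {A B : M3} {t s w : Fin 3 → ℝ} (hA : Ell A t) (hB : Ell B s) (hBA : Ell (B * A) w)
    (ht : ∀ k, NI (t k)) (hs : ∀ k, NI (s k)) (hw : ∀ k, NI (w k)) {k : ℕ}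
    (h : Ine (KK A B) k) {j : ℤ}
    (hj : (w 0 + w 1 + w 2) = (t 0 + t 1 + t 2) + (s 0 + s 1 + s 2) + j) :
    Even ((k : ℤ) + GG t + GG s + GG w + j) := by
  obtain ⟨r, hr, e⟩ := ine_det h
  have uA := hA.unit ht
  have uB := hB.unit hs
  have d1 : (RR A).det * (1 - A).det = 1 := by rw [← det_mul, RR_left uA, det_one]
  have d2 : (RR B).det * (1 - B).det = 1 := by rw [← det_mul, RR_left uB, det_one]
  have d3 : (KK A B).det = -(2 * Complex.I) ^ 3 * ((RR B).det * (1 - B * A).det * (RR A).det) := by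
    unfold KK
    rw [RR_sum uA uB, det_smul, det_mul, det_mul, det_mul, J3_det]
    simp
  have d4 : (KK A B).det * ((1 - A).det * (1 - B).det) =
      -(2 * Complex.I) ^ 3 * (1 - B * A).det := by
    rw [d3]
    linear_combination (-(2 * Complex.I) ^ 3 * (1 - B * A).det * ((RR B).det * (1 - B).det)) * d1
      + (-(2 * Complex.I) ^ 3 * (1 - B * A).det) * d2
  obtain ⟨r1, p1, e1⟩ := sin_prod_sign ht
  obtain ⟨r2, p2, e2⟩ := sin_prod_sign hs
  obtain ⟨r3, p3, e3⟩ := sin_prod_sign hw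
  rw [hA.det, hB.det, hBA.det, prod_one_sub_ex, prod_one_sub_ex, prod_one_sub_ex, hj,
    hx_add (t 0 + t 1 + t 2 + (s 0 + s 1 + s 2)) (j : ℝ),
    hx_add (t 0 + t 1 + t 2) (s 0 + s 1 + s 2), hx_int, e1, e2, e3, e] at d4
  have n1 := hx_ne (t 0 + t 1 + t 2)
  have n2 := hx_ne (s 0 + s 1 + s 2)
  have d5 : (((-1) ^ k * r * (((-1) ^ (⌊t 0⌋ + ⌊t 1⌋ + ⌊t 2⌋) * r1) *
      ((-1) ^ (⌊s 0⌋ + ⌊s 1⌋ + ⌊s 2⌋) * r2)) : ℝ) : ℂ) =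
      (((-1) ^ (⌊w 0⌋ + ⌊w 1⌋ + ⌊w 2⌋) * r3 * (-1) ^ j : ℝ) : ℂ) := by
    have hI : ((-2 * Complex.I) ^ 3 : ℂ) * (-2 * Complex.I) ^ 3 ≠ 0 := by
      have := Complex.I_ne_zero
      simp
    have hne := mul_ne_zero hI (mul_ne_zero n1 n2)
    apply mul_right_cancel₀ hne
    simp only [Complex.ofReal_mul] at d4 ⊢
    linear_combination d4
  have d6 : (-1 : ℝ) ^ ((k : ℤ) + ((⌊t 0⌋ + ⌊t 1⌋ + ⌊t 2⌋) + (⌊s 0⌋ + ⌊s 1⌋ + ⌊s 2⌋))) *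
      (r * r1 * r2) = (-1) ^ ((⌊w 0⌋ + ⌊w 1⌋ + ⌊w 2⌋) + j) * r3 := by
    have d5' := Complex.ofReal_injective d5
    rw [zpow_add₀ (by norm_num) (k : ℤ), zpow_natCast,
      zpow_add₀ (by norm_num) (⌊t 0⌋ + ⌊t 1⌋ + ⌊t 2⌋),
      zpow_add₀ (by norm_num) (⌊w 0⌋ + ⌊w 1⌋ + ⌊w 2⌋)]
    linear_combination d5'
  have d7 := sign_even (by positivity) p3 d6
  unfold GG
  rw [Int.even_iff] at d7 ⊢
  omega

lemma countable_notNI (c : ℝ) (ε : ℝ) (hε : ε ≠ 0) : {x : ℝ | ¬ NI (c + ε * x)}.Countable := by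
  have : {x : ℝ | ¬ NI (c + ε * x)} ⊆ Set.range (fun n : ℤ => ((n : ℝ) - c) / ε) := by
    intro x hx
    simp only [NI, not_forall, not_not, mem_ofPred_eq, ne_eq] at hx
    obtain ⟨n, hn⟩ := hx
    refine ⟨n, ?_⟩
    simp only
    rw [← hn]; field_simp; ring
  exact (Set.countable_range _).mono this

lemma exists_generic {ι : Type} [Countable ι] (c ε : ι → ℝ) (hε : ∀ i, ε i ≠ 0) :
    ∃ x : ℝ, ∀ i, NI (c i + ε i * x) := by
  have h : (⋃ i, {x : ℝ | ¬ NI (c i + ε i * x)}).Countable :=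
    Set.countable_iUnion fun i => countable_notNI _ _ (hε i)
  obtain ⟨x, hx⟩ := (h.dense_compl ℝ).nonempty
  refine ⟨x, fun i => ?_⟩
  by_contra hi
  exact hx (Set.mem_iUnion.2 ⟨i, hi⟩)

/-- generic twisting parameters -/
def Gen (t s v : Fin 3 → ℝ) (x y : ℝ) : Prop :=
  (∀ k, NI (t k + x)) ∧ (∀ k, NI (s k + y)) ∧ ∀ k, NI (v k - x - y)

/-- the jump function -/
def FF (t s v : Fin 3 → ℝ) (x y : ℝ) : ℤ :=
  GG (fun k => t k + x) + GG (fun k => s k + y) + GG (fun k => v k - x - y)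

section index

variable {A B C : M3} {t s v : Fin 3 → ℝ}

lemma Ell.prod (hA : Ell A t) (hC : Ell C v) (e : A * B * C = 1) (x y : ℝ) :
    Ell ((ex y • B) * (ex x • A)) (fun k => -(v k - x - y)) := by
  have h1 : Ell (A * B) (fun k => -v k) := hC.inv e
  have h2 : Ell (B * A) (fun k => -v k) := by
    obtain ⟨P, hP, e'⟩ := h1
    refine ⟨A⁻¹ * P, memU21_mul (memU21_inv hA.mem) hP, ?_⟩
    have hd := (isUnit_iff_isUnit_det _).1 (memU21_unit hA.mem)
    rw [Matrix.mul_inv_rev, nonsing_inv_nonsing_inv _ hd]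
    calc B * A = A⁻¹ * (A * B) * A := by
          rw [nonsing_inv_mul_cancel_left _ _ hd]
      _ = _ := by rw [e']; simp only [Matrix.mul_assoc]
  have h3 : (ex y • B) * (ex x • A) = ex (x + y) • (B * A) := by
    rw [smul_mul_assoc, mul_smul_comm, smul_smul, ex_add, mul_comm (ex x)]
  rw [h3]
  convert h2.smul (x + y) using 2
  ring

lemma NI_sub_comm {a x y : ℝ} (h : NI (a - x - y)) : NI (-(a - x - y)) := h.neg

lemma move_x (hA : Ell A t) (hB : Ell B s) (hC : Ell C v) (e : A * B * C = 1) {x x' y : ℝ}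
    (g : Gen t s v x y) (g' : Gen t s v x' y) (hxx : NI (x' - x)) {k k' : ℕ}
    (h : Ine (KK (ex x • A) (ex y • B)) k) (h' : Ine (KK (ex x' • A) (ex y • B)) k') :
    (k' : ℤ) - FF t s v x' y = k - FF t s v x y := by
  have e1 : ex x' • A = ex (x' - x) • (ex x • A) := by
    rw [smul_smul, ← ex_add, sub_add_cancel]
  rw [e1] at h'
  have c1 : (fun k => t k + x + (x' - x)) = fun k => t k + x' := by ext k; ring
  have c2 : (fun k => -(v k - x - y) + (x' - x)) = fun k => -(v k - x' - y) := by ext k; ring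
  have := step (hA.smul x) (hB.smul y) (hA.prod hC e x y) g.1 g.2.1 (fun k => (g.2.2 k).neg) hxx
    (fun k => by rw [congrFun c1 k]; exact g'.1 k)
    (fun k => by rw [congrFun c2 k]; exact (g'.2.2 k).neg) h h'
  rw [c1, c2, GG_neg g.2.2, GG_neg g'.2.2] at this
  unfold FF
  omega

lemma move_y (hA : Ell A t) (hB : Ell B s) (hC : Ell C v) (e : A * B * C = 1) {x y y' : ℝ}
    (g : Gen t s v x y) (g' : Gen t s v x y') (hyy : NI (y' - y)) {k k' : ℕ}
    (h : Ine (KK (ex x • A) (ex y • B)) k) (h' : Ine (KK (ex x • A) (ex y' • B)) k') :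
    (k' : ℤ) - FF t s v x y' = k - FF t s v x y := by
  have e1 : ex y' • B = ex (y' - y) • (ex y • B) := by
    rw [smul_smul, ← ex_add, sub_add_cancel]
  rw [KK_comm, e1] at h'
  rw [KK_comm] at h
  have c1 : (fun k => s k + y + (y' - y)) = fun k => s k + y' := by ext k; ring
  have c2 : (fun k => -(v k - x - y) + (y' - y)) = fun k => -(v k - x - y') := by ext k; ring
  have hp : Ell ((ex x • A) * (ex y • B)) (fun k => -(v k - x - y)) :=
    (hA.prod hC e x y).comm (hA.smul x).mem
  have := step (hB.smul y) (hA.smul x) hp g.2.1 g.1 (fun k => (g.2.2 k).neg) hyy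
    (fun k => by rw [congrFun c1 k]; exact g'.2.1 k)
    (fun k => by rw [congrFun c2 k]; exact (g'.2.2 k).neg) h h'
  rw [c1, c2, GG_neg g.2.2, GG_neg g'.2.2] at this
  unfold FF
  omega

lemma gen_index (hA : Ell A t) (hB : Ell B s) (hC : Ell C v) (e : A * B * C = 1) {x y : ℝ}
    (g : Gen t s v x y) : ∃ k : ℕ, k ≤ 3 ∧ Ine (KK (ex x • A) (ex y • B)) k :=
  KK_exists (hA.smul x) (hB.smul y) (hA.prod hC e x y) g.1 g.2.1 (fun k => (g.2.2 k).neg)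

lemma move_xy (hA : Ell A t) (hB : Ell B s) (hC : Ell C v) (e : A * B * C = 1) {x x' y y' : ℝ}
    (g : Gen t s v x y) (g' : Gen t s v x' y') {k k' : ℕ}
    (h : Ine (KK (ex x • A) (ex y • B)) k) (h' : Ine (KK (ex x' • A) (ex y' • B)) k') :
    (k' : ℤ) - FF t s v x' y' = k - FF t s v x y := by
  -- an intermediate generic point (x₁, y₁)
  obtain ⟨y₁, hy₁⟩ := exists_generic
    (ι := (Fin 3 ⊕ Fin 3) ⊕ Fin 2)
    (Sum.elim (Sum.elim s (fun k => v k - x)) ![-y, -y'])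
    (Sum.elim (Sum.elim (fun _ => 1) (fun _ => -1)) (fun _ => 1))
    (by rintro ((i | i) | i) <;> norm_num)
  obtain ⟨x₁, hx₁⟩ := exists_generic
    (ι := ((Fin 3 ⊕ Fin 3) ⊕ Fin 3) ⊕ Fin 2)
    (Sum.elim (Sum.elim (Sum.elim t (fun k => v k - y₁)) (fun k => v k - y')) ![-x, -x'])
    (Sum.elim (Sum.elim (Sum.elim (fun _ => 1) (fun _ => -1)) (fun _ => -1)) (fun _ => 1))
    (by rintro (((i | i) | i) | i) <;> norm_num)
  have a1 : ∀ k, NI (s k + y₁) := fun k => by simpa using hy₁ (Sum.inl (Sum.inl k))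
  have a2 : ∀ k, NI (v k - x - y₁) := fun k => by
    simpa [sub_eq_add_neg] using hy₁ (Sum.inl (Sum.inr k))
  have a3 : NI (y₁ - y) := by
    simpa [sub_eq_add_neg, add_comm] using hy₁ (Sum.inr 0)
  have a4 : NI (y' - y₁) := by
    have := (hy₁ (Sum.inr 1)).neg
    simpa [sub_eq_add_neg, add_comm] using this
  have b1 : ∀ k, NI (t k + x₁) := fun k => by simpa using hx₁ (Sum.inl (Sum.inl (Sum.inl k)))
  have b2 : ∀ k, NI (v k - x₁ - y₁) := fun k => by
    have := hx₁ (Sum.inl (Sum.inl (Sum.inr k)))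
    simp only [Sum.elim_inl, Sum.elim_inr] at this
    convert this using 1; ring
  have b2' : ∀ k, NI (v k - x₁ - y') := fun k => by
    have := hx₁ (Sum.inl (Sum.inr k))
    simp only [Sum.elim_inl, Sum.elim_inr] at this
    convert this using 1; ring
  have b3 : NI (x₁ - x) := by
    simpa [sub_eq_add_neg, add_comm] using hx₁ (Sum.inr 0)
  have b4 : NI (x' - x₁) := by
    have := (hx₁ (Sum.inr 1)).neg
    simpa [sub_eq_add_neg, add_comm] using this
  have g1 : Gen t s v x y₁ := ⟨g.1, a1, a2⟩
  have g2 : Gen t s v x₁ y₁ := ⟨b1, a1, b2⟩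
  have g3 : Gen t s v x₁ y' := ⟨b1, g'.2.1, b2'⟩
  obtain ⟨k1, -, i1⟩ := gen_index hA hB hC e g1
  obtain ⟨k2, -, i2⟩ := gen_index hA hB hC e g2
  obtain ⟨k3, -, i3⟩ := gen_index hA hB hC e g3
  have m1 := move_y hA hB hC e g g1 a3 h i1
  have m2 := move_x hA hB hC e g1 g2 b3 i1 i2
  have m3 := move_y hA hB hC e g2 g3 a4 i2 i3
  have m4 := move_x hA hB hC e g3 g' b4 i3 h'
  omega

/-- The index theorem: for suitable `T` the number `T + FF` is the index of a `3 × 3` form. -/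
lemma index_theorem (hA : Ell A t) (hB : Ell B s) (hC : Ell C v) (e : A * B * C = 1) {j : ℤ}
    (hj : (t 0 + t 1 + t 2) + (s 0 + s 1 + s 2) + (v 0 + v 1 + v 2) = j) :
    ∃ T : ℤ, Even (T + j + 1) ∧ ∀ x y, Gen t s v x y → 0 ≤ T + FF t s v x y ∧
      T + FF t s v x y ≤ 3 := by
  obtain ⟨y₀, hy₀⟩ := exists_generic s (fun _ => 1) (by norm_num)
  obtain ⟨x₀, hx₀⟩ := exists_generic (ι := Fin 3 ⊕ Fin 3)
    (Sum.elim t (fun k => v k - y₀)) (Sum.elim (fun _ => 1) (fun _ => -1))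
    (by rintro (i | i) <;> norm_num)
  have g : Gen t s v x₀ y₀ := by
    refine ⟨fun k => by simpa using hx₀ (Sum.inl k), fun k => by simpa using hy₀ k, fun k => ?_⟩
    have := hx₀ (Sum.inr k)
    simp only [Sum.elim_inr] at this
    convert this using 1; ring
  obtain ⟨k, hk, i⟩ := gen_index hA hB hC e g
  refine ⟨k - FF t s v x₀ y₀, ?_, ?_⟩
  · have hp := parity (hA.smul x₀) (hB.smul y₀) (hA.prod hC e x₀ y₀) g.1 g.2.1
      (fun k => (g.2.2 k).neg) i (j := -j) (by push_cast; linarith)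
    rw [GG_neg g.2.2] at hp
    unfold FF
    rw [Int.even_iff] at hp ⊢
    omega
  · intro x y g'
    obtain ⟨k', hk', i'⟩ := gen_index hA hB hC e g'
    have := move_xy hA hB hC e g g' i i'
    omega

end index
/-! ### One-sided limits of the jump function -/

/-- one-sided floor: right limit for `true`, left limit for `false` -/
def fl (p : Bool) (t : ℝ) : ℤ := if p then ⌊t⌋ else ⌈t⌉ - 1

/-- one-sided version of the index function of an elliptic element of type `(a₁, a₂)` -/
def gg (p : Bool) (a₁ a₂ x : ℝ) : ℤ := fl p (a₁ + x) + fl p (a₂ + x) - fl p x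

lemma fl_t (t : ℝ) : (fl true t : ℝ) ≤ t ∧ t < fl true t + 1 := by
  simp only [fl, if_true]
  exact ⟨Int.floor_le t, Int.lt_floor_add_one t⟩

lemma fl_f (t : ℝ) : (fl false t : ℝ) < t ∧ t ≤ fl false t + 1 := by
  simp only [fl]
  have h1 := Int.le_ceil t
  have h2 := Int.ceil_lt_add_one t
  simp only [Bool.false_eq_true, if_false, Int.cast_sub, Int.cast_one]
  constructor <;> linarith

lemma fl_t_eq {t : ℝ} {n : ℤ} (h : (n : ℝ) ≤ t) (h' : t < n + 1) : fl true t = n := by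
  simp only [fl, if_true]
  exact Int.floor_eq_iff.2 ⟨h, h'⟩

lemma fl_f_eq {t : ℝ} {n : ℤ} (h : (n : ℝ) < t) (h' : t ≤ n + 1) : fl false t = n := by
  obtain ⟨h1, h2⟩ := fl_f t
  have a : (n : ℝ) < fl false t + 1 := by linarith
  have b : (fl false t : ℝ) < n + 1 := by linarith
  have a' : n < fl false t + 1 := by exact_mod_cast a
  have b' : fl false t < n + 1 := by exact_mod_cast b
  omega

/-- the slope `P` has the sign prescribed by `p` -/
def Sgn (p : Bool) (P : ℝ) : Prop := if p then 0 < P else P < 0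

lemma NI_of_between {t : ℝ} {n : ℤ} (h : (n : ℝ) < t) (h' : t < n + 1) : NI t := by
  intro m hm
  rw [hm] at h h'
  have a : n < m := by exact_mod_cast h
  have b : m < n + 1 := by exact_mod_cast h'
  omega

lemma fl_limit (p : Bool) {P : ℝ} (hP : Sgn p P) (t : ℝ) :
    ∀ᶠ δ in nhdsWithin (0 : ℝ) (Set.Ioi 0), NI (t + P * δ) ∧ ⌊t + P * δ⌋ = fl p t := by
  have main : ∀ᶠ δ in nhdsWithin (0 : ℝ) (Set.Ioi 0),
      ((fl p t : ℤ) : ℝ) < t + P * δ ∧ t + P * δ < (fl p t : ℤ) + 1 := by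
    cases p
    · have hP' : P < 0 := by simpa [Sgn] using hP
      obtain ⟨h1, h2⟩ := fl_f t
      have : 0 < (t - fl false t) / (-P) := div_pos (by linarith) (by linarith)
      filter_upwards [Ioo_mem_nhdsGT this] with δ hδ
      have h3 := (lt_div_iff₀ (by linarith : 0 < -P)).1 hδ.2
      have h4 := mul_neg_of_neg_of_pos hP' hδ.1
      constructor <;> linarith
    · have hP' : 0 < P := by simpa [Sgn] using hP
      obtain ⟨h1, h2⟩ := fl_t t
      have : 0 < (fl true t + 1 - t) / P := div_pos (by linarith) (by linarith)
      filter_upwards [Ioo_mem_nhdsGT this] with δ hδ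
      have h3 := (lt_div_iff₀ hP').1 hδ.2
      have h4 := mul_pos hP' hδ.1
      constructor <;> linarith
  filter_upwards [main] with δ hδ
  exact ⟨NI_of_between hδ.1 hδ.2, Int.floor_eq_iff.2 ⟨hδ.1.le, hδ.2⟩⟩

lemma GG_limit (p : Bool) {P : ℝ} (hP : Sgn p P) (t : Fin 3 → ℝ) :
    ∀ᶠ δ in nhdsWithin (0 : ℝ) (Set.Ioi 0), (∀ k, NI (t k + P * δ)) ∧
      GG (fun k => t k + P * δ) = fl p (t 0) + fl p (t 1) - fl p (t 2) := by
  filter_upwards [fl_limit p hP (t 0), fl_limit p hP (t 1), fl_limit p hP (t 2)] with δ h0 h1 h2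
  refine ⟨fun k => ?_, ?_⟩
  · fin_cases k
    · exact h0.1
    · exact h1.1
    · exact h2.1
  · unfold GG
    rw [h0.2, h1.2, h2.2]

lemma exists_slopes (p q r : Bool) (h : ¬ (p = q ∧ q = r)) :
    ∃ P Q R : ℝ, P + Q + R = 0 ∧ Sgn p P ∧ Sgn q Q ∧ Sgn r R := by
  cases p <;> cases q <;> cases r <;> simp at h
  · exact ⟨-1, -1, 2, by norm_num, by norm_num [Sgn], by norm_num [Sgn], by norm_num [Sgn]⟩
  · exact ⟨-1, 2, -1, by norm_num, by norm_num [Sgn], by norm_num [Sgn], by norm_num [Sgn]⟩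
  · exact ⟨-2, 1, 1, by norm_num, by norm_num [Sgn], by norm_num [Sgn], by norm_num [Sgn]⟩
  · exact ⟨2, -1, -1, by norm_num, by norm_num [Sgn], by norm_num [Sgn], by norm_num [Sgn]⟩
  · exact ⟨1, -2, 1, by norm_num, by norm_num [Sgn], by norm_num [Sgn], by norm_num [Sgn]⟩
  · exact ⟨1, 1, -2, by norm_num, by norm_num [Sgn], by norm_num [Sgn], by norm_num [Sgn]⟩

/-- The bounds given by the index theorem, at one-sided limits. -/
def Bd (a₁ a₂ b₁ b₂ c₁ c₂ κ : ℝ) (T : ℤ) : Prop :=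
  ∀ (p q r : Bool) (x y z : ℝ), ¬ (p = q ∧ q = r) → x + y + z = κ →
    0 ≤ T + (gg p a₁ a₂ x + gg q b₁ b₂ y + gg r c₁ c₂ z) ∧
      T + (gg p a₁ a₂ x + gg q b₁ b₂ y + gg r c₁ c₂ z) ≤ 3

lemma Bd.cyc {a₁ a₂ b₁ b₂ c₁ c₂ κ : ℝ} {T : ℤ} (h : Bd a₁ a₂ b₁ b₂ c₁ c₂ κ T) :
    Bd b₁ b₂ c₁ c₂ a₁ a₂ κ T := by
  intro p q r x y z hs hk
  have := h r p q z x y (fun hh => hs ⟨hh.2, hh.2.symm.trans hh.1.symm⟩) (by linarith)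
  constructor <;> linarith [this.1, this.2]

/-- angles of the standard lift -/
def Lang (a₁ a₂ : ℝ) : Fin 3 → ℝ := ![(2 * a₁ - a₂) / 3, (2 * a₂ - a₁) / 3, -(a₁ + a₂) / 3]

lemma Bd_of_ell {A B C : M3} {a₁ a₂ b₁ b₂ c₁ c₂ : ℝ} {m : ℤ} (hA : Ell A (Lang a₁ a₂))
    (hB : Ell B (Lang b₁ b₂)) (hC : Ell C (fun k => Lang c₁ c₂ k + -(m : ℝ) / 3))
    (e : A * B * C = 1) :
    ∃ T : ℤ, Even (T + m + 1) ∧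
      Bd a₁ a₂ b₁ b₂ c₁ c₂ (-((a₁ + a₂ + b₁ + b₂ + c₁ + c₂) + m) / 3) T := by
  obtain ⟨T, hT, hb⟩ := index_theorem hA hB hC e (j := -m) (by
    simp [Lang]; ring)
  refine ⟨T, ?_, ?_⟩
  · rw [Int.even_iff] at hT ⊢
    omega
  intro p q r x y z hs hk
  obtain ⟨P, Q, R, hsum, hP, hQ, hR⟩ := exists_slopes p q r hs
  have l1 := GG_limit p hP ![a₁ + x, a₂ + x, x]
  have l2 := GG_limit q hQ ![b₁ + y, b₂ + y, y]
  have l3 := GG_limit r hR ![c₁ + z, c₂ + z, z]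
  obtain ⟨δ, ⟨n1, f1⟩, ⟨n2, f2⟩, ⟨n3, f3⟩⟩ := (l1.and (l2.and l3)).exists
  have c1 : ∀ k, Lang a₁ a₂ k + (x + P * δ + (a₁ + a₂) / 3) =
      (![a₁ + x, a₂ + x, x] : Fin 3 → ℝ) k + P * δ := by
    intro k; fin_cases k <;> simp [Lang] <;> ring
  have c2 : ∀ k, Lang b₁ b₂ k + (y + Q * δ + (b₁ + b₂) / 3) =
      (![b₁ + y, b₂ + y, y] : Fin 3 → ℝ) k + Q * δ := by
    intro k; fin_cases k <;> simp [Lang] <;> ring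
  have hz : z = -((a₁ + a₂ + b₁ + b₂ + c₁ + c₂) + m) / 3 - x - y := by linarith
  have hR' : R = -P - Q := by linarith
  have c3 : ∀ k, Lang c₁ c₂ k + -(m : ℝ) / 3 - (x + P * δ + (a₁ + a₂) / 3) -
      (y + Q * δ + (b₁ + b₂) / 3) = (![c₁ + z, c₂ + z, z] : Fin 3 → ℝ) k + R * δ := by
    intro k; rw [hz, hR']; fin_cases k <;> simp [Lang] <;> ring
  have := hb (x + P * δ + (a₁ + a₂) / 3) (y + Q * δ + (b₁ + b₂) / 3)
    ⟨fun k => by rw [c1]; exact n1 k, fun k => by rw [c2]; exact n2 k,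
      fun k => by rw [c3]; exact n3 k⟩
  unfold FF at this
  simp only [c1, c2, c3] at this
  rw [f1, f2, f3] at this
  simpa [gg] using this
/-! ### Values of the one-sided index functions -/

/-- the open alcove, in units of `2π` -/
def Alc (a₁ a₂ : ℝ) : Prop := 0 < a₂ ∧ a₂ < a₁ ∧ a₁ < 1

lemma gg_t_eq {a₁ a₂ x : ℝ} (n₁ n₂ n₃ : ℤ) (h1 : (n₁ : ℝ) ≤ a₁ + x ∧ a₁ + x < n₁ + 1)
    (h2 : (n₂ : ℝ) ≤ a₂ + x ∧ a₂ + x < n₂ + 1) (h3 : (n₃ : ℝ) ≤ x ∧ x < n₃ + 1) :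
    gg true a₁ a₂ x = n₁ + n₂ - n₃ := by
  unfold gg
  rw [fl_t_eq h1.1 h1.2, fl_t_eq h2.1 h2.2, fl_t_eq h3.1 h3.2]

lemma gg_f_eq {a₁ a₂ x : ℝ} (n₁ n₂ n₃ : ℤ) (h1 : (n₁ : ℝ) < a₁ + x ∧ a₁ + x ≤ n₁ + 1)
    (h2 : (n₂ : ℝ) < a₂ + x ∧ a₂ + x ≤ n₂ + 1) (h3 : (n₃ : ℝ) < x ∧ x ≤ n₃ + 1) :
    gg false a₁ a₂ x = n₁ + n₂ - n₃ := by
  unfold gg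
  rw [fl_f_eq h1.1 h1.2, fl_f_eq h2.1 h2.2, fl_f_eq h3.1 h3.2]

section values

variable {a₁ a₂ : ℝ}

lemma gt_one (h : Alc a₁ a₂) : gg true a₁ a₂ (-a₁) = 0 := by
  obtain ⟨h1, h2, h3⟩ := h
  rw [gg_t_eq 0 (-1) (-1)] <;> first | norm_num; done | (constructor <;> push_cast <;> linarith)

lemma gt_two (h : Alc a₁ a₂) : gg true a₁ a₂ (-a₂) = 1 := by
  obtain ⟨h1, h2, h3⟩ := h
  rw [gg_t_eq 0 0 (-1)] <;> first | norm_num; done | (constructor <;> push_cast <;> linarith)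

lemma gt_zero (h : Alc a₁ a₂) : gg true a₁ a₂ 0 = 0 := by
  obtain ⟨h1, h2, h3⟩ := h
  rw [gg_t_eq 0 0 0] <;> first | norm_num; done | (constructor <;> push_cast <;> linarith)

lemma gf_one (h : Alc a₁ a₂) : gg false a₁ a₂ (-a₁) = -1 := by
  obtain ⟨h1, h2, h3⟩ := h
  rw [gg_f_eq (-1) (-1) (-1)] <;> first | norm_num; done | (constructor <;> push_cast <;> linarith)

lemma gf_two (h : Alc a₁ a₂) : gg false a₁ a₂ (-a₂) = 0 := by
  obtain ⟨h1, h2, h3⟩ := h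
  rw [gg_f_eq 0 (-1) (-1)] <;> first | norm_num; done | (constructor <;> push_cast <;> linarith)

lemma gf_zero (h : Alc a₁ a₂) : gg false a₁ a₂ 0 = 1 := by
  obtain ⟨h1, h2, h3⟩ := h
  rw [gg_f_eq 0 0 (-1)] <;> first | norm_num; done | (constructor <;> push_cast <;> linarith)

lemma gf_lower (h : Alc a₁ a₂) (z : ℝ) : z - 1 + a₁ ≤ gg false a₁ a₂ z := by
  obtain ⟨h1, h2, h3⟩ := h
  have q1 := fl_f (a₁ + z)
  have q2 := fl_f (a₂ + z)
  have q3 := fl_f z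
  have : (fl false z : ℝ) < fl false (a₂ + z) + 1 := by linarith
  have h4 : fl false z < fl false (a₂ + z) + 1 := by exact_mod_cast this
  have h5 : fl false z ≤ fl false (a₂ + z) := by omega
  have h6 : (fl false z : ℝ) ≤ fl false (a₂ + z) := by exact_mod_cast h5
  unfold gg
  push_cast
  linarith

lemma gt_upper (h : Alc a₁ a₂) (z : ℝ) : (gg true a₁ a₂ z : ℝ) ≤ z + 1 + a₂ := by
  obtain ⟨h1, h2, h3⟩ := h
  have q1 := fl_t (a₁ + z)
  have q2 := fl_t (a₂ + z)
  have q3 := fl_t z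
  have : (fl true (a₁ + z) : ℝ) < fl true z + 2 := by linarith
  have h4 : fl true (a₁ + z) < fl true z + 2 := by exact_mod_cast this
  have h5 : fl true (a₁ + z) ≤ fl true z + 1 := by omega
  have h6 : (fl true (a₁ + z) : ℝ) ≤ fl true z + 1 := by exact_mod_cast h5
  unfold gg
  push_cast
  linarith

lemma gf_nonneg (h : Alc a₁ a₂) {z : ℝ} (hz : -a₁ < z) : 0 ≤ gg false a₁ a₂ z := by
  have := gf_lower h z
  have h1 : (-1 : ℝ) < gg false a₁ a₂ z := by linarith
  have h2 : -1 < gg false a₁ a₂ z := by exact_mod_cast h1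
  omega

lemma gt_nonpos (h : Alc a₁ a₂) {z : ℝ} (hz : z < -a₂) : gg true a₁ a₂ z ≤ 0 := by
  have := gt_upper h z
  have h1 : (gg true a₁ a₂ z : ℝ) < 1 := by linarith
  have h2 : gg true a₁ a₂ z < 1 := by exact_mod_cast h1
  omega

end values

/-! ### Consequences of the bounds -/

section cells

variable {a₁ a₂ b₁ b₂ c₁ c₂ κ : ℝ} {T : ℤ}

lemma pt_two (h : Bd a₁ a₂ b₁ b₂ c₁ c₂ κ T)
    (ha : Alc a₁ a₂) (hb : Alc b₁ b₂) (hc : Alc c₁ c₂)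
    {z : ℝ} (hz : z = κ + a₂ + b₂) : T + 2 + gg false c₁ c₂ z ≤ 3 := by
  have := (h true true false (-a₂) (-b₂) z (by simp) (by linarith)).2
  rw [gt_two ha, gt_two hb] at this
  omega

lemma pt_one (h : Bd a₁ a₂ b₁ b₂ c₁ c₂ κ T)
    (ha : Alc a₁ a₂) (hb : Alc b₁ b₂) (hc : Alc c₁ c₂)
    {z : ℝ} (hz : z = κ + a₁ + b₁) : 0 ≤ T - 2 + gg true c₁ c₂ z := by
  have := (h false false true (-a₁) (-b₁) z (by simp) (by linarith)).1
  rw [gf_one ha, gf_one hb] at this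
  omega

lemma T_up (h : Bd a₁ a₂ b₁ b₂ c₁ c₂ κ T)
    (ha : Alc a₁ a₂) (hb : Alc b₁ b₂) (hc : Alc c₁ c₂)
    : (T : ℝ) ≤ 2 - (a₂ + b₂ + c₁ + κ) := by
  have h1 := pt_two h ha hb hc rfl
  have h2 := gf_lower hc (κ + a₂ + b₂)
  have h3 : ((T + 2 + gg false c₁ c₂ (κ + a₂ + b₂) : ℤ) : ℝ) ≤ ((3 : ℤ) : ℝ) := by
    exact_mod_cast h1
  push_cast at h3
  linarith

lemma T_lo (h : Bd a₁ a₂ b₁ b₂ c₁ c₂ κ T)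
    (ha : Alc a₁ a₂) (hb : Alc b₁ b₂) (hc : Alc c₁ c₂)
    : 1 - (a₁ + b₁ + c₂ + κ) ≤ (T : ℝ) := by
  have h1 := pt_one h ha hb hc rfl
  have h2 := gt_upper hc (κ + a₁ + b₁)
  have h3 : ((0 : ℤ) : ℝ) ≤ ((T - 2 + gg true c₁ c₂ (κ + a₁ + b₁) : ℤ) : ℝ) := by
    exact_mod_cast h1
  push_cast at h3
  linarith

lemma T_pin (h : Bd a₁ a₂ b₁ b₂ c₁ c₂ κ T)
    (ha : Alc a₁ a₂) (hb : Alc b₁ b₂) (hc : Alc c₁ c₂)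
    {m : ℤ} (hm0 : 0 ≤ m) (hm : m ≤ 2)
    (hκ : κ = -((a₁ + a₂ + b₁ + b₂ + c₁ + c₂) + m) / 3) : 1 ≤ T ∧ T ≤ 2 := by
  have u1 := T_up h ha hb hc
  have u2 := T_up h.cyc hb hc ha
  have u3 := T_up h.cyc.cyc hc ha hb
  have l1 := T_lo h ha hb hc
  have l2 := T_lo h.cyc hb hc ha
  have l3 := T_lo h.cyc.cyc hc ha hb
  obtain ⟨x1, x2, x3⟩ := ha
  obtain ⟨y1, y2, y3⟩ := hb
  obtain ⟨z1, z2, z3⟩ := hc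
  have hm0' : (0 : ℝ) ≤ m := by exact_mod_cast hm0
  have hm' : (m : ℝ) ≤ 2 := by exact_mod_cast hm
  have h1 : (T : ℝ) < 3 := by linarith
  have h2 : (0 : ℝ) < T := by linarith
  have h3 : T < 3 := by exact_mod_cast h1
  have h4 : 0 < T := by exact_mod_cast h2
  omega

-- cells for `u = ω`

lemma cell4_H (h : Bd a₁ a₂ b₁ b₂ c₁ c₂ κ T)
    (ha : Alc a₁ a₂) (hb : Alc b₁ b₂) (hc : Alc c₁ c₂)
    (hT : T = 2) (hz : -c₁ < κ + a₂ + b₂) : False := by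
  have h1 := pt_two h ha hb hc rfl
  have h2 := gf_nonneg hc hz
  omega

lemma cell4_S (h : Bd a₁ a₂ b₁ b₂ c₁ c₂ κ T)
    (ha : Alc a₁ a₂) (hb : Alc b₁ b₂) (hc : Alc c₁ c₂)
    (hT : T = 2) (hκ : κ < -1) (hH : -1 < κ + a₂ + b₂ + c₂) : False := by
  obtain ⟨x1, x2, x3⟩ := id ha
  obtain ⟨y1, y2, y3⟩ := id hb
  obtain ⟨z1, z2, z3⟩ := id hc
  rcases lt_or_ge (-1) (κ + c₂) with k1 | k1
  · have e := (h false false true 0 0 κ (by simp) (by ring)).2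
    have e1 : gg true c₁ c₂ κ = (-1) + (-1) - (-2) := by
      apply gg_t_eq <;> constructor <;> push_cast <;> linarith
    rw [gf_zero ha, gf_zero hb, e1] at e
    omega
  · rcases lt_or_ge (-1) (κ + c₂ + b₂) with k2 | k2
    · have e := (h false false true 0 (κ + c₂) (-c₂) (by simp) (by ring)).2
      have e1 : gg false b₁ b₂ (κ + c₂) = (-1) + (-1) - (-2) := by
        apply gg_f_eq <;> constructor <;> push_cast <;> linarith
      rw [gf_zero ha, gt_two hc, e1] at e
      omega
    · have e := (h false true true (κ + b₂ + c₂) (-b₂) (-c₂) (by simp) (by ring)).2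
      have e1 : gg false a₁ a₂ (κ + b₂ + c₂) = (-1) + (-1) - (-2) := by
        apply gg_f_eq <;> constructor <;> push_cast <;> linarith
      rw [gt_two hb, gt_two hc, e1] at e
      omega

lemma cell4_one (h : Bd a₁ a₂ b₁ b₂ c₁ c₂ κ T)
    (ha : Alc a₁ a₂) (hb : Alc b₁ b₂) (hc : Alc c₁ c₂)
    (hT : T = 2) (hz : κ + a₁ + b₁ < -c₁) (hz' : -1 ≤ κ + a₁ + b₁) : False := by
  obtain ⟨z1, z2, z3⟩ := id hc
  have h1 := pt_one h ha hb hc rfl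
  have e1 : gg true c₁ c₂ (κ + a₁ + b₁) = (-1) + (-1) - (-1) := by
    apply gg_t_eq <;> constructor <;> push_cast <;> linarith
  omega

-- cells for `u = 1` and `u = ω²`

lemma cell6_two (h : Bd a₁ a₂ b₁ b₂ c₁ c₂ κ T)
    (ha : Alc a₁ a₂) (hb : Alc b₁ b₂) (hc : Alc c₁ c₂)
    (hT : T = 1) (hz : -c₂ < κ + a₂ + b₂) (hz' : κ + a₂ + b₂ ≤ 0) : False := by
  obtain ⟨z1, z2, z3⟩ := id hc
  have h1 := pt_two h ha hb hc rfl
  have e1 : gg false c₁ c₂ (κ + a₂ + b₂) = 0 + 0 - (-1) := by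
    apply gg_f_eq <;> constructor <;> push_cast <;> linarith
  omega

lemma cell6_one (h : Bd a₁ a₂ b₁ b₂ c₁ c₂ κ T)
    (ha : Alc a₁ a₂) (hb : Alc b₁ b₂) (hc : Alc c₁ c₂)
    (hT : T = 1) (hz : 0 ≤ κ + a₁ + b₁) (hz' : κ + a₁ + b₁ < 1 - c₁) : False := by
  obtain ⟨z1, z2, z3⟩ := id hc
  have h1 := pt_one h ha hb hc rfl
  have e1 : gg true c₁ c₂ (κ + a₁ + b₁) = 0 + 0 - 0 := by
    apply gg_t_eq <;> constructor <;> push_cast <;> linarith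
  omega

lemma cell8_H (h : Bd a₁ a₂ b₁ b₂ c₁ c₂ κ T)
    (ha : Alc a₁ a₂) (hb : Alc b₁ b₂) (hc : Alc c₁ c₂)
    (hT : T = 1) (hz : κ + a₁ + b₁ < -c₂) : False := by
  have h1 := pt_one h ha hb hc rfl
  have h2 := gt_nonpos hc hz
  omega

lemma cell8_S (h : Bd a₁ a₂ b₁ b₂ c₁ c₂ κ T)
    (ha : Alc a₁ a₂) (hb : Alc b₁ b₂) (hc : Alc c₁ c₂)
    (hT : T = 1) (hκ : -2 < κ) (hH : κ + a₁ + b₁ + c₁ < 1) : False := by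
  obtain ⟨x1, x2, x3⟩ := id ha
  obtain ⟨y1, y2, y3⟩ := id hb
  obtain ⟨z1, z2, z3⟩ := id hc
  rcases le_or_gt (κ + c₁) (-1) with k1 | k1
  · have e := (h true true false 0 0 κ (by simp) (by ring)).1
    have e1 : gg false c₁ c₂ κ = (-2) + (-2) - (-2) := by
      apply gg_f_eq <;> constructor <;> push_cast <;> linarith
    rw [gt_zero ha, gt_zero hb, e1] at e
    omega
  · rcases le_or_gt (κ + c₁ + b₁) 0 with k2 | k2
    · have e := (h true false false 0 (κ + c₁) (-c₁) (by simp) (by ring)).1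
      have e1 : gg false b₁ b₂ (κ + c₁) = (-1) + (-1) - (-1) := by
        apply gg_f_eq <;> constructor <;> push_cast <;> linarith
      rw [gt_zero ha, gf_one hc, e1] at e
      omega
    · have e := (h true false false (κ + b₁ + c₁) (-b₁) (-c₁) (by simp) (by ring)).1
      have e1 : gg true a₁ a₂ (κ + b₁ + c₁) = 0 + 0 - 0 := by
        apply gg_t_eq <;> constructor <;> push_cast <;> linarith
      rw [gf_one hb, gf_one hc, e1] at e
      omega

end cells
/-! ### Assembling the proof -/

lemma omg_eq : omg = ex (((1 : ℤ) : ℝ) / 3) := by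
  unfold omg ex; congr 1; push_cast; ring

lemma omg_sq_eq : omg ^ 2 = ex (((2 : ℤ) : ℝ) / 3) := by
  unfold omg ex; rw [← Complex.exp_nat_mul]; congr 1; push_cast; ring

lemma one_eq : (1 : ℂ) = ex (((0 : ℤ) : ℝ) / 3) := by simp [ex]

lemma Lmat_eq (a₁ a₂ : ℝ) :
    Lmat (2 * π * a₁) (2 * π * a₂) = diagonal (fun k => ex (Lang a₁ a₂ k)) := by
  unfold Lmat
  congr 1
  ext k
  fin_cases k <;> simp [Lang, ex] <;> congr 1 <;> ring

lemma Alc_of_mem {p : Pt} (h : memTo p) : ∃ a₁ a₂ : ℝ, p = (2 * π * a₁, 2 * π * a₂) ∧ Alc a₁ a₂ := by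
  obtain ⟨x, y⟩ := p
  obtain ⟨h1, h2, h3⟩ := h
  have hp : 0 < 2 * π := by positivity
  refine ⟨x / (2 * π), y / (2 * π), ?_, by exact div_pos h1 hp,
    by exact div_lt_div_of_pos_right h2 hp, ?_⟩
  · rw [mul_div_cancel₀ _ hp.ne', mul_div_cancel₀ _ hp.ne']
  · rw [div_lt_one hp]; exact h3

lemma Psol_Bd {m : ℤ} (hm0 : 0 ≤ m) (hm : m ≤ 2) {τ : Tri} (h : τ ∈ Psol (ex ((m : ℝ) / 3)))
    (ho : memTo3 τ) : ∃ (a₁ a₂ b₁ b₂ c₁ c₂ κ : ℝ) (T : ℤ),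
      τ = ((2 * π * a₁, 2 * π * a₂), (2 * π * b₁, 2 * π * b₂), (2 * π * c₁, 2 * π * c₂)) ∧
      Alc a₁ a₂ ∧ Alc b₁ b₂ ∧ Alc c₁ c₂ ∧ κ = -((a₁ + a₂ + b₁ + b₂ + c₁ + c₂) + m) / 3 ∧
      Bd a₁ a₂ b₁ b₂ c₁ c₂ κ T ∧ Even (T + m + 1) ∧ 1 ≤ T ∧ T ≤ 2 := by
  obtain ⟨α, β, γ⟩ := τ
  obtain ⟨o1, o2, o3⟩ := ho
  obtain ⟨a₁, a₂, rfl, ha⟩ := Alc_of_mem o1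
  obtain ⟨b₁, b₂, rfl, hb⟩ := Alc_of_mem o2
  obtain ⟨c₁, c₂, rfl, hc⟩ := Alc_of_mem o3
  obtain ⟨-, A, B, C, -, -, -, ⟨P, hP, eA⟩, ⟨Q, hQ, eB⟩, ⟨R, hR, eC⟩, e⟩ := h
  simp only [Lmat_eq] at eA eB eC
  have hA : Ell A (Lang a₁ a₂) := ⟨P, hP, eA⟩
  have hB : Ell B (Lang b₁ b₂) := ⟨Q, hQ, eB⟩
  have hC : Ell C (Lang c₁ c₂) := ⟨R, hR, eC⟩
  have e' : A * B * (ex (-(m : ℝ) / 3) • C) = 1 := by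
    rw [mul_smul_comm, e, smul_smul, neg_div, ex_neg, one_smul]
  obtain ⟨T, hT, hB'⟩ := Bd_of_ell hA hB (hC.smul (-(m : ℝ) / 3)) e'
  exact ⟨a₁, a₂, b₁, b₂, c₁, c₂, _, T, rfl, ha, hb, hc, rfl, hB', hT,
    T_pin hB' ha hb hc hm0 hm rfl⟩

lemma unscale {x y : ℝ} (h : 2 * π * x < 2 * π * y) : x < y :=
  lt_of_mul_lt_mul_left h (by positivity)

lemma cells_omg {τ : Tri} (h : τ ∈ Psol omg) (ho : memTo3 τ) (hc : τ ∈ C41 ∪ C42) : False := by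
  rw [omg_eq] at h
  obtain ⟨a₁, a₂, b₁, b₂, c₁, c₂, κ, T, rfl, iA, iB, iC, hκ, hB, hev, t1, t2⟩ :=
    Psol_Bd (by norm_num) (by norm_num) h ho
  have hT : T = 2 := by rw [Int.even_iff] at hev; omega
  obtain ⟨x1, x2, x3⟩ := id iA
  obtain ⟨y1, y2, y3⟩ := id iB
  obtain ⟨z1, z2, z3⟩ := id iC
  push_cast at hκ
  rcases hc with ⟨-, h2, h3⟩ | ⟨-, h1⟩
  · simp [Hf, sg, coord, Sf] at h2 h3
    have h2' := @unscale (-2) (2 * (a₂ + b₂ + c₂) - (a₁ + b₁ + c₁)) (by linarith)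
    rcases h3 with h3 | h3 | h3 | h3
    · have h4 := @unscale 2 (a₁ + a₂ + b₁ + b₂ + c₁ + c₂) (by linarith)
      exact cell4_S hB iA iB iC hT (by linarith) (by linarith)
    · have h4 := @unscale 1 (2 * (a₁ + b₂ + c₂) - (a₂ + b₁ + c₁)) (by linarith)
      exact cell4_H hB.cyc iB iC iA hT (by linarith)
    · have h4 := @unscale 1 (2 * (a₂ + b₁ + c₂) - (a₁ + b₂ + c₁)) (by linarith)
      exact cell4_H hB.cyc.cyc iC iA iB hT (by linarith)
    · have h4 := @unscale 1 (2 * (a₂ + b₂ + c₁) - (a₁ + b₁ + c₂)) (by linarith)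
      exact cell4_H hB iA iB iC hT (by linarith)
  · simp [Hf, sg, coord] at h1
    have h4 := @unscale (2 * (a₁ + b₁ + c₁) - (a₂ + b₂ + c₂)) 1 (by linarith)
    exact cell4_one hB iA iB iC hT (by linarith) (by linarith)

lemma cells_one {τ : Tri} (h : τ ∈ Psol 1) (ho : memTo3 τ) (hc : τ ∈ C6c) : False := by
  rw [one_eq] at h
  obtain ⟨a₁, a₂, b₁, b₂, c₁, c₂, κ, T, rfl, iA, iB, iC, hκ, hB, hev, t1, t2⟩ :=
    Psol_Bd (by norm_num) (by norm_num) h ho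
  have hT : T = 1 := by rw [Int.even_iff] at hev; omega
  obtain ⟨x1, x2, x3⟩ := id iA
  obtain ⟨y1, y2, y3⟩ := id iB
  obtain ⟨z1, z2, z3⟩ := id iC
  push_cast at hκ
  rcases hc with ⟨-, h1 | h1⟩
  · simp [Hf, sg, coord] at h1
    have h4 := @unscale 0 (2 * (a₂ + b₂ + c₂) - (a₁ + b₁ + c₁)) (by linarith)
    rcases le_or_gt (κ + a₂ + b₂) 0 with k | k
    · exact cell6_two hB iA iB iC hT (by linarith) k
    rcases le_or_gt (κ + b₂ + c₂) 0 with k' | k'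
    · exact cell6_two hB.cyc iB iC iA hT (by linarith) k'
    · exact cell6_two hB.cyc.cyc iC iA iB hT (by linarith) (by linarith)
  · simp [Hf, sg, coord] at h1
    have h4 := @unscale (2 * (a₁ + b₁ + c₁) - (a₂ + b₂ + c₂)) 3 (by linarith)
    rcases le_or_gt 0 (κ + a₁ + b₁) with k | k
    · exact cell6_one hB iA iB iC hT k (by linarith)
    rcases le_or_gt 0 (κ + b₁ + c₁) with k' | k'
    · exact cell6_one hB.cyc iB iC iA hT k' (by linarith)
    · exact cell6_one hB.cyc.cyc iC iA iB hT (by linarith) (by linarith)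

lemma cells_omg_sq {τ : Tri} (h : τ ∈ Psol (omg ^ 2)) (ho : memTo3 τ) (hc : τ ∈ C81 ∪ C82) :
    False := by
  rw [omg_sq_eq] at h
  obtain ⟨a₁, a₂, b₁, b₂, c₁, c₂, κ, T, rfl, iA, iB, iC, hκ, hB, hev, t1, t2⟩ :=
    Psol_Bd (by norm_num) (by norm_num) h ho
  have hT : T = 1 := by rw [Int.even_iff] at hev; omega
  obtain ⟨x1, x2, x3⟩ := id iA
  obtain ⟨y1, y2, y3⟩ := id iB
  obtain ⟨z1, z2, z3⟩ := id iC
  push_cast at hκ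
  rcases hc with ⟨-, h2, h3⟩ | ⟨-, h1⟩
  · simp [Hf, sg, coord, Sf] at h2 h3
    have h2' := @unscale (2 * (a₁ + b₁ + c₁) - (a₂ + b₂ + c₂)) 5 (by linarith)
    rcases h3 with h3 | h3 | h3 | h3
    · have h4 := @unscale (a₁ + a₂ + b₁ + b₂ + c₁ + c₂) 4 (by linarith)
      exact cell8_S hB iA iB iC hT (by linarith) (by linarith)
    · have h4 := @unscale (2 * (a₂ + b₁ + c₁) - (a₁ + b₂ + c₂)) 2 (by linarith)
      exact cell8_H hB.cyc iB iC iA hT (by linarith)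
    · have h4 := @unscale (2 * (a₁ + b₂ + c₁) - (a₂ + b₁ + c₂)) 2 (by linarith)
      exact cell8_H hB.cyc.cyc iC iA iB hT (by linarith)
    · have h4 := @unscale (2 * (a₁ + b₁ + c₂) - (a₂ + b₂ + c₁)) 2 (by linarith)
      exact cell8_H hB iA iB iC hT (by linarith)
  · simp [Hf, sg, coord] at h1
    have h4 := @unscale 2 (2 * (a₂ + b₂ + c₂) - (a₁ + b₁ + c₁)) (by linarith)
    exact cell6_two hB iA iB iC hT (by linarith) (by linarith)

/-- Empty cells: no solutions with the corresponding lift over the complement cells. -/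
theorem empty_cells :
    Psol omg ∩ (C41 ∪ C42) ∩ {τ : Tri | memTo3 τ} = ∅ ∧
    Psol 1 ∩ C6c ∩ {τ : Tri | memTo3 τ} = ∅ ∧
    Psol (omg ^ 2) ∩ (C81 ∪ C82) ∩ {τ : Tri | memTo3 τ} = ∅ := by
  refine ⟨?_, ?_, ?_⟩
  · exact Set.eq_empty_iff_forall_notMem.2 fun τ h => cells_omg h.1.1 h.2 h.1.2
  · exact Set.eq_empty_iff_forall_notMem.2 fun τ h => cells_one h.1.1 h.2 h.1.2
  · exact Set.eq_empty_iff_forall_notMem.2 fun τ h => cells_omg_sq h.1.1 h.2 h.1.2
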